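/- arXiv:1507.01917 — 4 statements merged into one kernel-verified Lean document; each statement's English description precedes it below -/
import Mathlib

section
/- Let F be a field of characteristic p > 0, and let Q be a finite group whose Sylow p-subgroups are cyclic. Then for every finite-dimensional F-linear representation M of Q and every j ≥ 0, dim_F H^j(Q, M) ≤ dim_F M. -/
open CategoryTheory

/-- The homology of a short complex of vector spaces is a subquotient of its middle term. -/
lemma CategoryTheory.ShortComplex.moduleCat_finite_homology_and_finrank_le {k : Type*} [Field k]
    (S : ShortComplex (ModuleCat k)) [FiniteDimensional k S.X₂] :
    FiniteDimensional k S.homology ∧ Module.finrank k S.homology ≤ Module.finrank k S.X₂ := by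
  let e : S.homology ≃ₗ[k] LinearMap.ker S.g.hom ⧸ LinearMap.range S.moduleCatToCycles :=
    S.moduleCatHomologyIso.toLinearEquiv
  refine ⟨Module.Finite.equiv e.symm, ?_⟩
  rw [e.finrank_eq]
  exact (Submodule.finrank_quotient_le _).trans (Submodule.finrank_le _)

namespace Rep

universe u

variable {k G : Type u} [CommRing k] [Group G] (S : Subgroup G) (A : Rep.{u} k G)

/-- The unit `A ⟶ Coind_S^G (Res_S A)`, sending `a` to `g ↦ ρ(g) a`. -/
noncomputable def toCoindRes : A ⟶ coind S.subtype (res S.subtype A) :=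
  resCoindToHom S.subtype A (res S.subtype A) (𝟙 _)

/-- The summand `ρ(g) f(g⁻¹)` of the relative trace depends only on the coset `g S`. -/
noncomputable def coindResTraceTerm (f : coind S.subtype (res S.subtype A)) (q : G ⧸ S) : A :=
  Quotient.liftOn q (fun g => A.ρ g (f.1 g⁻¹)) fun a b hab => by
    have hs : a⁻¹ * b ∈ S := QuotientGroup.leftRel_apply.1 hab
    have h := f.2 ⟨a⁻¹ * b, hs⟩ b⁻¹
    have hf : f.1 a⁻¹ = A.ρ (a⁻¹ * b) (f.1 b⁻¹) := by simpa using h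
    simp only [hf, ← Module.End.mul_apply, ← map_mul, mul_inv_cancel_left]

lemma coindResTraceTerm_mk (f : coind S.subtype (res S.subtype A)) (g : G) :
    coindResTraceTerm S A f (g : G ⧸ S) = A.ρ g (f.1 g⁻¹) := rfl

/-- The relative trace `Coind_S^G (Res_S A) ⟶ A`, sending `f` to `∑ ρ(g) f(g⁻¹)` over `G ⧸ S`. -/
noncomputable def coindResTrace [Fintype (G ⧸ S)] :
    coind S.subtype (res S.subtype A) ⟶ A :=
  Rep.ofHom ⟨
    { toFun f := ∑ q : G ⧸ S, coindResTraceTerm S A f q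
      map_add' f f' := by
        rw [← Finset.sum_add_distrib]
        refine Finset.sum_congr rfl fun q _ => ?_
        induction q using QuotientGroup.induction_on
        simp [coindResTraceTerm_mk]
      map_smul' c f := by
        rw [RingHom.id_apply, Finset.smul_sum]
        refine Finset.sum_congr rfl fun q _ => ?_
        induction q using QuotientGroup.induction_on
        simp [coindResTraceTerm_mk] },
    fun h => by
      refine LinearMap.ext fun f => ?_
      change ∑ q : G ⧸ S, coindResTraceTerm S A ((coind S.subtype (res S.subtype A)).ρ h f) q =
        A.ρ h (∑ q : G ⧸ S, coindResTraceTerm S A f q)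
      rw [map_sum, ← Equiv.sum_comp (MulAction.toPerm h : Equiv.Perm (G ⧸ S))]
      refine Finset.sum_congr rfl fun q _ => ?_
      induction q using QuotientGroup.induction_on with | _ g
      change A.ρ (h * g) (f.1 ((h * g)⁻¹ * h)) = A.ρ h (A.ρ g (f.1 g⁻¹))
      simp⟩

/-- On `A`, restriction followed by the relative trace is multiplication by the index. -/
lemma toCoindRes_comp_coindResTrace [Fintype (G ⧸ S)] :
    toCoindRes S A ≫ coindResTrace S A = (S.index : k) • 𝟙 A := by
  ext a
  change ∑ q : G ⧸ S, coindResTraceTerm S A ((toCoindRes S A).hom a) q = (S.index : k) • a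
  have h (q : G ⧸ S) : coindResTraceTerm S A ((toCoindRes S A).hom a) q = a := by
    induction q using QuotientGroup.induction_on with | _ g
    change A.ρ g (A.ρ g⁻¹ a) = a
    simp
  simp [h, Subgroup.index, Nat.card_eq_fintype_card, Nat.cast_smul_eq_nsmul]

end Rep

namespace groupCohomology

universe u

variable {k G : Type u} [Field k] [Group G] (A : Rep.{u} k G)

/-- The cohomology of a finite cyclic group is, in every degree, a subquotient of the
coefficients. -/
lemma finite_and_finrank_le_of_isCyclic [Finite G] [IsCyclic G] [FiniteDimensional k A.V]
    (j : ℕ) :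
    FiniteDimensional k (groupCohomology A j) ∧
      Module.finrank k (groupCohomology A j) ≤ Module.finrank k A.V := by
  have := Fintype.ofFinite G
  let _ : CommGroup G := IsCyclic.commGroup
  obtain ⟨g, hg⟩ := IsCyclic.exists_generator (α := G)
  have key (S : ShortComplex (ModuleCat k)) (e : groupCohomology A j ≅ S.homology)
      [FiniteDimensional k S.X₂] : FiniteDimensional k (groupCohomology A j) ∧
        Module.finrank k (groupCohomology A j) ≤ Module.finrank k S.X₂ := by
    obtain ⟨_, h⟩ := S.moduleCat_finite_homology_and_finrank_le
    exact ⟨Module.Finite.equiv e.symm.toLinearEquiv, e.toLinearEquiv.finrank_eq.trans_le h⟩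
  obtain rfl | hj := eq_or_ne j 0
  · let e : groupCohomology A 0 ≃ₗ[k] A.ρ.invariants := (H0Iso A).toLinearEquiv
    exact ⟨Module.Finite.equiv e.symm, e.finrank_eq.trans_le (Submodule.finrank_le _)⟩
  have : NeZero j := ⟨hj⟩
  obtain he | ho := Nat.even_or_odd j
  · have : FiniteDimensional k (Rep.FiniteCyclicGroup.normHomCompSub A g).X₂ :=
      ‹FiniteDimensional k A.V›
    exact key _ (Rep.FiniteCyclicGroup.groupCohomologyIsoEven A g hg j he)
  · have : FiniteDimensional k (Rep.FiniteCyclicGroup.subCompNormHom A g).X₂ :=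
      ‹FiniteDimensional k A.V›
    exact key _ (Rep.FiniteCyclicGroup.groupCohomologyIsoOdd A g hg j ho)

/-- If the index of `S` is invertible in `k`, then `Hʲ(G, A)` embeds into `Hʲ(S, A)`. -/
lemma exists_injective_res_of_index_ne_zero (S : Subgroup G) (hS : (S.index : k) ≠ 0) (j : ℕ) :
    ∃ f : groupCohomology A j →ₗ[k] groupCohomology (Rep.res S.subtype A) j,
      Function.Injective f := by
  have : S.FiniteIndex := ⟨fun h => hS (by simp [h])⟩
  let _ := S.fintypeQuotientOfFiniteIndex
  let s : SplitMono (Rep.toCoindRes S A) :=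
    ⟨(S.index : k)⁻¹ • Rep.coindResTrace S A, by
      rw [Linear.comp_smul, Rep.toCoindRes_comp_coindResTrace, smul_smul, inv_mul_cancel₀ hS,
        one_smul]⟩
  have : Mono ((functor k G j).map (Rep.toCoindRes S A)) := (s.map (functor k G j)).mono
  let e := (coindIso (Rep.res S.subtype A) j).toLinearEquiv
  exact ⟨e.toLinearMap ∘ₗ ((functor k G j).map (Rep.toCoindRes S A)).hom,
    e.injective.comp ((ModuleCat.mono_iff_injective _).1 this)⟩

end groupCohomology

/-- Let `F` be a field of characteristic `p > 0`, and let `Q` be a finite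
group whose Sylow `p`-subgroups are cyclic.  Then for every finite-dimensional `F`-linear
representation `M` of `Q` and every `j ≥ 0`, `dim_F H^j(Q, M) ≤ dim_F M`. -/
theorem finrank_groupCohomology_le_of_isCyclic_sylow
    (p : ℕ) [Fact p.Prime] (F : Type) [Field F] [CharP F p]
    (Q : Type) [Group Q] [Fintype Q]
    (hSyl : ∀ P : Sylow p Q, IsCyclic ↥P)
    (M : Rep F Q) [FiniteDimensional F M.V] (j : ℕ) :
    Module.finrank F (groupCohomology M j) ≤ Module.finrank F M.V := by
  obtain ⟨P⟩ : Nonempty (Sylow p Q) := inferInstance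
  have : IsCyclic (P : Subgroup Q) := hSyl P
  have hP : ((P : Subgroup Q).index : F) ≠ 0 := by
    rw [Ne, CharP.cast_eq_zero_iff F p]
    exact P.not_dvd_index
  have : FiniteDimensional F (Rep.res (P : Subgroup Q).subtype M).V := ‹FiniteDimensional F M.V›
  obtain ⟨_, hle⟩ := groupCohomology.finite_and_finrank_le_of_isCyclic
    (Rep.res (P : Subgroup Q).subtype M) j
  obtain ⟨f, hf⟩ := groupCohomology.exists_injective_res_of_index_ne_zero M (P : Subgroup Q) hP j
  exact (LinearMap.finrank_le_finrank_of_injective hf).trans hle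
end

section
/- Let F be a field of characteristic p > 0, and let Q be a finite group whose Sylow p-subgroups are cyclic. If M is a nonzero finite-dimensional F-linear representation of Q that is indecomposable (i.e., whenever M is isomorphic to a direct sum M₁ ⊕ M₂ of representations, one of M₁, M₂ is zero), then for every j ≥ 0, dim_F H^j(Q, M) ≤ 1. -/
/-- A representation `M` of `G` over `k` is *indecomposable* if it is nonzero and whenever
`M` is the internal direct sum of two subrepresentations (`G`-invariant subspaces), one of
them is zero. -/
def Rep.Indecomposable {k : Type} [Field k] {G : Type} [Group G] (M : Rep k G) : Prop :=
  Nontrivial M.V ∧ ∀ U V : Submodule k M.V,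
    (∀ g : G, ∀ x ∈ U, M.ρ g x ∈ U) → (∀ g : G, ∀ x ∈ V, M.ρ g x ∈ V) →
    U ⊓ V = ⊥ → U ⊔ V = ⊤ → U = ⊥ ∨ V = ⊥


open CategoryTheory Polynomial
open scoped DirectSum

theorem Module.End.exists_sum_eq_one_of_cyclic {F : Type} [Field F] {V : Type} [AddCommGroup V]
    [Module F V] [FiniteDimensional F V] (f : Module.End F V) :
    ∃ (ι : Type) (_ : Fintype ι) (e : ι → Module.End F V),
      (∀ i, Commute f (e i)) ∧ ∑ i, e i = 1 ∧
      ∀ i, ∃ v, ∀ x, ∃ (c : F) (y : V), e i x = c • e i v + (f (e i y) - e i y) := by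
  classical
  obtain ⟨ι, _, p, -, n, ⟨e⟩⟩ := Module.equiv_directSum_of_isTorsion
    (R := F[X]) (M := Module.AEval' f) (Module.AEval.isTorsion_of_finiteDimensional F V f)
  let a (i : ι) : Module.AEval' f →ₗ[F[X]] F[X] ⧸ F[X] ∙ p i ^ n i :=
    DirectSum.component F[X] ι (fun i ↦ F[X] ⧸ F[X] ∙ p i ^ n i) i ∘ₗ e.toLinearMap
  let b (i : ι) : (F[X] ⧸ F[X] ∙ p i ^ n i) →ₗ[F[X]] Module.AEval' f :=
    e.symm.toLinearMap ∘ₗ DirectSum.lof F[X] ι (fun i ↦ F[X] ⧸ F[X] ∙ p i ^ n i) i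
  have hab (i : ι) (x) : a i (b i x) = x := by simp [a, b, DirectSum.component.lof_self]
  let E (i : ι) : Module.End F V :=
    (Module.AEval'.of f).symm.toLinearMap ∘ₗ ((b i ∘ₗ a i).restrictScalars F) ∘ₗ
      (Module.AEval'.of f).toLinearMap
  have hE (i : ι) (x : V) : E i x =
    (Module.AEval'.of f).symm (b i (a i (Module.AEval'.of f x))) := rfl
  have hf (x : Module.AEval' f) : f ((Module.AEval'.of f).symm x) =
      (Module.AEval'.of f).symm ((X : F[X]) • x) := by
    rw [Module.AEval'.of_symm_X_smul]
  refine ⟨ι, inferInstance, E, fun i ↦ ?_, ?_, fun i ↦ ?_⟩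
  · refine LinearMap.ext fun x ↦ ?_
    rw [Module.End.mul_apply, Module.End.mul_apply, hE, hE, hf, ← Module.AEval'.X_smul_of,
      map_smul (a i), map_smul (b i)]
  · refine LinearMap.ext fun x ↦ ?_
    rw [LinearMap.sum_apply]
    simp only [hE]
    rw [← map_sum, Module.End.one_apply, LinearEquiv.symm_apply_eq]
    apply e.injective
    rw [map_sum]
    simp only [a, b, LinearMap.comp_apply, LinearEquiv.coe_coe, LinearEquiv.apply_symm_apply]
    exact DirectSum.sum_univ_of _
  · refine ⟨(Module.AEval'.of f).symm (b i (Submodule.Quotient.mk 1)), fun x ↦ ?_⟩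
    obtain ⟨q, hq⟩ := Submodule.Quotient.mk_surjective _ (a i (Module.AEval'.of f x))
    obtain ⟨r, hr⟩ : (X - C 1 : F[X]) ∣ q - C (q.eval 1) := X_sub_C_dvd_sub_C_eval
    have hq' : q = C (q.eval 1) • (1 : F[X]) + ((X : F[X]) • r - r) := by
      rw [sub_eq_iff_eq_add'] at hr
      simp only [smul_eq_mul, mul_one]
      conv_lhs => rw [hr]
      simp only [map_one]
      ring
    refine ⟨q.eval 1, (Module.AEval'.of f).symm (b i (Submodule.Quotient.mk r)), ?_⟩
    simp only [hE, LinearEquiv.apply_symm_apply, hab, hf, ← hq]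
    conv_lhs => rw [hq']
    rw [Submodule.Quotient.mk_add, Submodule.Quotient.mk_sub, Submodule.Quotient.mk_smul,
      Submodule.Quotient.mk_smul, map_add, map_sub, map_smul, map_smul, Module.AEval.C_smul,
      map_add, map_sub, map_smul]

theorem LinearMap.finrank_ker_eq_finrank_quotient_range {F V : Type} [Field F] [AddCommGroup V]
    [Module F V] [FiniteDimensional F V] (f : V →ₗ[F] V) :
    Module.finrank F (LinearMap.ker f) = Module.finrank F (V ⧸ LinearMap.range f) := by
  have := f.finrank_range_add_finrank_ker
  have := (LinearMap.range f).finrank_quotient_add_finrank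
  omega

theorem Rep.FiniteCyclicGroup.rank_groupCohomology_le_one {F G : Type} [Field F] [CommGroup G]
    [Fintype G] (A : Rep F G) [FiniteDimensional F A.V] (g : G)
    (hg : ∀ x, x ∈ Subgroup.zpowers g)
    (hA : Module.finrank F (A.V ⧸ LinearMap.range (A.ρ g - 1)) ≤ 1) (n : ℕ) :
    Module.rank F (groupCohomology A n) ≤ 1 := by
  have hD : (applyAsHom A g - 𝟙 A).hom.toLinearMap = A.ρ g - 1 := by
    ext; simp [sub_hom]
  have hker : Module.rank F (ModuleCat.of F
      (LinearMap.ker (applyAsHom A g - 𝟙 A).hom.toLinearMap)) ≤ 1 := by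
    change Module.rank F (LinearMap.ker (applyAsHom A g - 𝟙 A).hom.toLinearMap) ≤ 1
    rw [hD, ← Module.finrank_eq_rank, LinearMap.finrank_ker_eq_finrank_quotient_range]
    exact_mod_cast hA
  rcases eq_or_ne n 0 with rfl | hn
  · rwa [(groupCohomologyIso₀ A g hg).toLinearEquiv.rank_eq]
  have : NeZero n := ⟨hn⟩
  rcases Nat.even_or_odd n with he | ho
  · have : Epi (groupCohomologyπEven A g hg n he) :=
      @epi_comp _ _ _ _ _ _
        (@IsIso.epi_of_iso _ _ _ _ _
          (ShortComplex.moduleCatCyclesIso (normHomCompSub A g)).isIso_inv) _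
        (epi_comp _ _)
    exact ((groupCohomologyπEven A g hg n he).hom.rank_le_of_surjective
      ((ModuleCat.epi_iff_surjective _).1 this)).trans hker
  · let π := (groupCohomologyπOdd A g hg n ho).hom
    have hs : Function.Surjective π := by
      have : Epi (groupCohomologyπOdd A g hg n ho) :=
        @epi_comp _ _ _ _ _ _
        (@IsIso.epi_of_iso _ _ _ _ _
          (ShortComplex.moduleCatCyclesIso (subCompNormHom A g)).isIso_inv) _
        (epi_comp _ _)
      exact (ModuleCat.epi_iff_surjective _).1 this
    let q : LinearMap.ker A.norm.hom.toLinearMap →ₗ[F] A.V ⧸ LinearMap.range (A.ρ g - 1) :=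
      (LinearMap.range (A.ρ g - 1)).mkQ ∘ₗ Submodule.subtype _
    have hq : LinearMap.ker π = LinearMap.ker q := by
      ext x
      rw [LinearMap.mem_ker, LinearMap.mem_ker]
      refine (groupCohomologyπOdd_eq_zero_iff A g hg n ho x).trans ?_
      rw [hD]
      simp [q, -LinearMap.mem_range]
    rw [← (π.quotKerEquivOfSurjective hs).rank_eq, hq, q.quotKerEquivRange.rank_eq]
    refine (Submodule.rank_le _).trans ?_
    rw [← Module.finrank_eq_rank]
    exact_mod_cast hA

theorem exists_isUnit_of_isUnit_sum {R ι : Type*} [Ring R] [Nontrivial R]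
    (hR : ∀ a : R, IsUnit a ∨ IsUnit (1 - a)) (s : Finset ι) (f : ι → R)
    (h : IsUnit (∑ i ∈ s, f i)) : ∃ i ∈ s, IsUnit (f i) := by
  classical
  induction s using Finset.induction_on with
  | empty => simp at h
  | insert i s hi ih =>
    rw [Finset.sum_insert hi] at h
    obtain ⟨u, hu⟩ := h
    have h1 : 1 - ↑u⁻¹ * f i = ↑u⁻¹ * ∑ j ∈ s, f j := by
      rw [sub_eq_iff_eq_add', ← mul_add, ← hu, Units.inv_mul]
    rcases hR (↑u⁻¹ * f i) with h | h
    · exact ⟨i, by simp, (Units.isUnit_units_mul _ _).1 h⟩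
    · rw [h1, Units.isUnit_units_mul] at h
      obtain ⟨j, hj, hj'⟩ := ih h
      exact ⟨j, by simp [hj], hj'⟩

theorem Rep.isIso_of_bijective {F G : Type} [Field F] [Group G] {A B : Rep F G} (f : A ⟶ B)
    (hf : Function.Bijective f.hom) : IsIso f := by
  have := (Rep.mono_iff_injective f).2 hf.1
  have := (Rep.epi_iff_surjective f).2 hf.2
  exact isIso_of_mono_of_epi f

theorem Rep.Indecomposable.isUnit_or_isUnit_one_sub {F G : Type} [Field F] [Group G] {M : Rep F G}
    [FiniteDimensional F M.V] (hM : M.Indecomposable) (f : End M) :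
    IsUnit f ∨ IsUnit (1 - f) := by
  let φ : Module.End F M.V := f.hom.toLinearMap
  have hφ (g : G) : Commute φ (M.ρ g) := f.hom.isIntertwining' g
  obtain ⟨n, hn, hc⟩ := ((Filter.eventually_ge_atTop 1).and
    φ.eventually_isCompl_ker_pow_range_pow).exists
  have hφn (g : G) (x : M.V) : (φ ^ n) (M.ρ g x) = M.ρ g ((φ ^ n) x) :=
    LinearMap.congr_fun ((hφ g).pow_left n) x
  rcases hM.2 (LinearMap.ker (φ ^ n)) (LinearMap.range (φ ^ n))
    (fun g x hx ↦ by
      rw [LinearMap.mem_ker] at hx ⊢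
      rw [hφn, hx, map_zero])
    (by
      rintro g _ ⟨x, rfl⟩
      exact ⟨M.ρ g x, hφn g x⟩)
    hc.inf_eq_bot hc.sup_eq_top with h | h
  · left
    have hu : IsUnit φ := (isUnit_pow_iff (by omega)).1 ((LinearMap.isUnit_iff_ker_eq_bot _).2 h)
    exact (isUnit_iff_isIso f).2 (Rep.isIso_of_bijective f ((Module.End.isUnit_iff φ).1 hu))
  · right
    have hu : IsUnit (1 - φ) := IsNilpotent.isUnit_one_sub ⟨n, LinearMap.range_eq_bot.1 h⟩
    refine (isUnit_iff_isIso (1 - f)).2 (Rep.isIso_of_bijective _ ?_)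
    exact (Module.End.isUnit_iff (1 - φ)).1 hu

theorem Rep.FiniteCyclicGroup.rank_groupCohomology_le_one_of_forall_mem_zpowers {F G : Type}
    [Field F] [Group G] [Finite G] (A : Rep F G) [FiniteDimensional F A.V] (g : G)
    (hg : ∀ x, x ∈ Subgroup.zpowers g)
    (hA : Module.finrank F (A.V ⧸ LinearMap.range (A.ρ g - 1)) ≤ 1) (n : ℕ) :
    Module.rank F (groupCohomology A n) ≤ 1 := by
  have := Fintype.ofFinite G
  have : IsCyclic G := ⟨g, hg⟩
  obtain ⟨c, hc⟩ : ∃ c : CommGroup G, c.toGroup = ‹Group G› := ⟨IsCyclic.commGroup, rfl⟩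
  subst hc
  exact rank_groupCohomology_le_one A g hg hA n

section Transfer

variable {F G : Type} [Field F] [Group G] {S : Subgroup G} {M : Rep F G} {A : Rep F S}

/-- The value at `x` of the function summed in `Rep.coindTrace`, sending `φ` to `x • f (φ x⁻¹)`. -/
noncomputable def Rep.coindTraceTerm (f : A ⟶ res S.subtype M) (x : G) :
    A.ρ.coindV S.subtype →ₗ[F] M.V :=
  M.ρ x ∘ₗ f.hom.toLinearMap ∘ₗ LinearMap.proj x⁻¹ ∘ₗ Submodule.subtype _

theorem Rep.coindTraceTerm_apply (f : A ⟶ res S.subtype M) (x : G) (φ : A.ρ.coindV S.subtype) :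
    coindTraceTerm f x φ = M.ρ x (f.hom (φ.1 x⁻¹)) := rfl

theorem Rep.coindTraceTerm_congr (f : A ⟶ res S.subtype M) {x y : G}
    (h : (x : G ⧸ S) = y) : coindTraceTerm f x = coindTraceTerm f y := by
  ext φ
  obtain ⟨s, rfl⟩ : ∃ s : S, y = x * s :=
    ⟨⟨x⁻¹ * y, QuotientGroup.eq.1 h⟩, by simp⟩
  have h1 : φ.1 (x * s : G)⁻¹ = A.ρ s⁻¹ (φ.1 x⁻¹) := by
    rw [← φ.2 s⁻¹ x⁻¹]
    simp
  rw [coindTraceTerm_apply, coindTraceTerm_apply, h1, hom_comm_apply]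
  simp [← Module.End.mul_apply, ← map_mul]

/-- For a subgroup `S` of finite index, the morphism from the representation coinduced from `A`
to `M` that extends an `S`-equivariant map `f : A ⟶ M` by summing over left cosets of `S`. -/
noncomputable def Rep.coindTrace [Fintype (G ⧸ S)] (f : A ⟶ res S.subtype M) :
    coind S.subtype A ⟶ M :=
  Rep.ofHom ⟨∑ q : G ⧸ S, coindTraceTerm f q.out, fun g ↦ by
    refine LinearMap.ext fun φ ↦ ?_
    simp only [LinearMap.comp_apply, LinearMap.sum_apply, map_sum]
    refine Fintype.sum_equiv (MulAction.toPerm g⁻¹) _ _ fun q ↦ ?_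
    have h : (((MulAction.toPerm g⁻¹ q).out : G) : G ⧸ S) = (g⁻¹ * q.out : G) := by
      rw [QuotientGroup.out_eq', MulAction.toPerm_apply, ← MulAction.Quotient.coe_smul_out,
        smul_eq_mul]
    rw [coindTraceTerm_congr f h, coindTraceTerm_apply, coindTraceTerm_apply]
    simp [← Module.End.mul_apply, ← map_mul]
    rfl⟩

theorem Rep.resCoindToHom_comp_coindTrace_apply [Fintype (G ⧸ S)] (a : res S.subtype M ⟶ A)
    (b : A ⟶ res S.subtype M) (m : M.V) :
    (resCoindToHom S.subtype M A a ≫ coindTrace b).hom m =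
      ∑ q : G ⧸ S, M.ρ q.out (b.hom (a.hom (M.ρ q.out⁻¹ m))) := by
  change (∑ q : G ⧸ S, coindTraceTerm b q.out) _ = _
  rw [LinearMap.sum_apply]
  rfl

end Transfer

theorem Rep.rank_groupCohomology_le_of_isIso {F G : Type} [Field F] [Group G] {S : Subgroup G}
    {M : Rep F G} {A : Rep F S} (u : M ⟶ coind S.subtype A) (v : coind S.subtype A ⟶ M)
    [IsIso (u ≫ v)] (n : ℕ) :
    Module.rank F (groupCohomology M n) ≤ Module.rank F (groupCohomology A n) := by
  rw [← (groupCohomology.coindIso A n).toLinearEquiv.rank_eq]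
  have h : Mono ((groupCohomology.functor F G n).map u) := by
    have : Mono ((groupCohomology.functor F G n).map u ≫
        (groupCohomology.functor F G n).map v) := by
      rw [← Functor.map_comp]
      infer_instance
    exact mono_of_mono _ ((groupCohomology.functor F G n).map v)
  exact LinearMap.rank_le_of_injective ((groupCohomology.functor F G n).map u).hom
    ((ModuleCat.mono_iff_injective _).1 h)

/-- Let `F` be a field of characteristic `p > 0`, and let `Q` be a finite
group whose Sylow `p`-subgroups are cyclic.  If `M` is a nonzero finite-dimensional
indecomposable `F`-linear representation of `Q`, then for every `j ≥ 0`,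
`dim_F H^j(Q, M) ≤ 1`. -/
theorem finrank_groupCohomology_le_one_of_indecomposable
    (p : ℕ) [Fact p.Prime] (F : Type) [Field F] [CharP F p]
    (Q : Type) [Group Q] [Fintype Q]
    (hSyl : ∀ P : Sylow p Q, IsCyclic ↥P)
    (M : Rep F Q) [FiniteDimensional F M.V] (hM : M.Indecomposable) (j : ℕ) :
    Module.finrank F (groupCohomology M j) ≤ 1 := by
  obtain ⟨P⟩ : Nonempty (Sylow p Q) := inferInstance
  obtain ⟨g, hg⟩ := (hSyl P).exists_generator
  have : Nontrivial M.V := hM.1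
  have : Nontrivial (End M) := by
    refine ⟨0, 1, fun h ↦ ?_⟩
    obtain ⟨x, hx⟩ := exists_ne (0 : M.V)
    exact hx (congr_arg (fun f : End M ↦ f.hom x) h).symm
  have : Fintype (Q ⧸ (P : Subgroup Q)) := Fintype.ofFinite _
  obtain ⟨ι, _, e, hcomm, hsum, he⟩ :=
    Module.End.exists_sum_eq_one_of_cyclic (M.ρ (g : Q))
  have hcomm' (i : ι) (x : P) (m : M.V) : e i (M.ρ x m) = M.ρ x (e i m) := by
    obtain ⟨n, rfl⟩ := mem_powers_iff_mem_zpowers.2 (hg x)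
    have := LinearMap.congr_fun ((hcomm i).pow_left n) m
    simpa using this.symm
  let R : Rep F P := Rep.res (P : Subgroup Q).subtype M
  let A (i : ι) : Rep F P := R.subrepresentation (LinearMap.range (e i)) (by
    rintro x _ ⟨m, rfl⟩
    exact ⟨M.ρ x m, hcomm' i x m⟩)
  have hfin (i : ι) : FiniteDimensional F (A i).V :=
    inferInstanceAs (FiniteDimensional F (LinearMap.range (e i)))
  let a (i : ι) : R ⟶ A i := Rep.ofHom ⟨(e i).rangeRestrict, fun x ↦
    LinearMap.ext fun m ↦ Subtype.ext (hcomm' i x m)⟩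
  let b (i : ι) : A i ⟶ R := Rep.ofHom ⟨(LinearMap.range (e i)).subtype, fun _ ↦ rfl⟩
  let u (i : ι) : End M := Rep.resCoindToHom _ M (A i) (a i) ≫ Rep.coindTrace (b i)
  have hu : ∑ i, u i = ((P : Subgroup Q).index : F) • (1 : End M) := by
    refine Rep.hom_ext (Representation.IntertwiningMap.ext (LinearMap.ext fun m ↦ ?_))
    have h1 : (∑ i, u i).hom m = ∑ i, (u i).hom m := by
      rw [Rep.sum_hom]
      exact Representation.IntertwiningMap.sum_apply _ _ _ _ _
    refine h1.trans ?_
    have h2 (i : ι) : (u i).hom m =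
        ∑ q : Q ⧸ (P : Subgroup Q), M.ρ q.out (e i (M.ρ q.out⁻¹ m)) :=
      Rep.resCoindToHom_comp_coindTrace_apply (a i) (b i) m
    have h3 (m : M.V) : ∑ i, e i m = m := by
      rw [← LinearMap.sum_apply, hsum, Module.End.one_apply]
    have h4 (q : Q ⧸ (P : Subgroup Q)) : ∑ i, M.ρ q.out (e i (M.ρ q.out⁻¹ m)) = m := by
      rw [← map_sum, h3, Representation.self_inv_apply]
    refine (Finset.sum_congr rfl fun i _ ↦ h2 i).trans ?_
    refine Finset.sum_comm.trans ((Finset.sum_congr rfl fun q _ ↦ h4 q).trans ?_)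
    rw [Finset.sum_const, Finset.card_univ, ← Nat.card_eq_fintype_card,
      ← Subgroup.index_eq_card, ← Nat.cast_smul_eq_nsmul F]
    rfl
  have hindex : ((P : Subgroup Q).index : F) ≠ 0 := by
    rw [Ne, CharP.cast_eq_zero_iff F p]
    exact P.not_dvd_index
  have hunit : IsUnit (∑ i, u i) := by
    rw [hu]
    exact (isUnit_one.smul (Units.mk0 _ hindex))
  obtain ⟨i, -, hi⟩ := exists_isUnit_of_isUnit_sum hM.isUnit_or_isUnit_one_sub _ u hunit
  have hiso : IsIso (Rep.resCoindToHom _ M (A i) (a i) ≫ Rep.coindTrace (b i)) :=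
    (isUnit_iff_isIso _).1 hi
  refine Module.finrank_le_of_rank_le (n := 1) ?_
  refine (Rep.rank_groupCohomology_le_of_isIso (Rep.resCoindToHom _ M (A i) (a i))
    (Rep.coindTrace (b i)) j).trans ?_
  rw [Nat.cast_one]
  refine Rep.FiniteCyclicGroup.rank_groupCohomology_le_one_of_forall_mem_zpowers (A i) g hg ?_ j
  obtain ⟨v, hv⟩ := he i
  refine finrank_le_one (Submodule.Quotient.mk ((e i).rangeRestrict v)) fun w ↦ ?_
  obtain ⟨⟨_, x, rfl⟩, rfl⟩ := Submodule.Quotient.mk_surjective _ w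
  obtain ⟨c, y, h⟩ := hv x
  refine ⟨c, ?_⟩
  rw [← Submodule.Quotient.mk_smul, eq_comm, Submodule.Quotient.eq]
  refine ⟨(e i).rangeRestrict y, Subtype.ext ?_⟩
  exact (sub_eq_of_eq_add' h).symm
end

section
/- Let F be a field of characteristic 2, and let Q be a finite group whose Sylow 2-subgroup is isomorphic to the dihedral group of order 2^{m+1} for some m ≥ 1 (i.e., to DihedralGroup (2^m)). Then for every finite-dimensional F-linear representation M of Q, dim_F H^2(Q, M) ≤ 3 · dim_F M. -/
open CategoryTheory groupCohomology

universe u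

/-- The universal property of the dihedral group: a rotation `a` and a reflection `b` satisfying
the dihedral relations in `E` define a homomorphism from the dihedral group to `E`. -/
theorem DihedralGroup.exists_hom_of_relations {n : ℕ} {E : Type*} [Group E] (a b : E)
    (ha : a ^ n = 1) (hb : b * b = 1) (hab : b * a * (b * a) = 1) :
    ∃ φ : DihedralGroup n →* E, φ (r 1) = a ∧ φ (sr 0) = b := by
  let α : ZMod n →+ Additive E :=
    ZMod.lift n ⟨zmultiplesHom (Additive E) (Additive.ofMul a), by
      simpa [← ofMul_pow] using ha⟩
  let β : ZMod n → E := fun i => (α i).toMul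
  have hβ_add (i j : ZMod n) : β (i + j) = β i * β j := by simp [β]
  have hβ_int (i : ℤ) : β i = a ^ i := by simp [β, α]
  have hb_inv : b⁻¹ = b := inv_eq_of_mul_eq_one_right hb
  have hconj : b * a * b⁻¹ = a⁻¹ := by
    rw [hb_inv]
    exact eq_inv_of_mul_eq_one_left (by simpa [mul_assoc] using hab)
  have hβ_conj (i : ZMod n) : β i * b = b * β (-i) := by
    obtain ⟨i, rfl⟩ := ZMod.intCast_surjective i
    have h : b * a ^ (-i) * b⁻¹ = a ^ i := by
      rw [← conj_zpow, hconj, inv_zpow', neg_neg]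
    rw [← Int.cast_neg, hβ_int, hβ_int, ← h]
    simp
  have hβ_zero : β 0 = 1 := by simp [β]
  refine ⟨MonoidHom.mk' (fun x => match x with
    | r i => β i
    | sr i => b * β i) ?_, ?_, ?_⟩
  · rintro (i | i) (j | j)
    · simp [hβ_add]
    · simp only [r_mul_sr]
      rw [← mul_assoc, hβ_conj, mul_assoc, ← hβ_add, neg_add_eq_sub]
    · simp [hβ_add, mul_assoc]
    · simp only [sr_mul_sr]
      rw [mul_assoc, ← mul_assoc (β i), hβ_conj, mul_assoc, ← hβ_add, ← mul_assoc, hb, one_mul,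
        neg_add_eq_sub]
  · simpa using hβ_int 1
  · simp [hβ_zero]

/-- The extension of `G` by `A` defined by a 2-cocycle `f`. -/
@[ext]
structure CocycleExtension {k G : Type u} [CommRing k] [Group G] {A : Rep.{u} k G}
    (f : cocycles₂ A) where
  /-- The component in the module. -/
  fst : A.V
  /-- The component in the group. -/
  snd : G

namespace CocycleExtension

variable {k G : Type u} [CommRing k] [Group G] {A : Rep.{u} k G} {f : cocycles₂ A}

theorem cocycle_rel (f : cocycles₂ A) (g h j : G) :
    f (g * h, j) + f (g, h) = A.ρ g (f (h, j)) + f (g, h * j) :=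
  (mem_cocycles₂_iff f).1 f.2 g h j

instance : Mul (CocycleExtension f) where
  mul x y := ⟨x.fst + A.ρ x.snd y.fst + f (x.snd, y.snd), x.snd * y.snd⟩

instance : One (CocycleExtension f) where
  one := ⟨-f (1, 1), 1⟩

instance : Inv (CocycleExtension f) where
  inv x := ⟨-f (1, 1) - A.ρ x.snd⁻¹ x.fst - f (x.snd⁻¹, x.snd), x.snd⁻¹⟩

@[simp] theorem mul_fst (x y : CocycleExtension f) :
    (x * y).fst = x.fst + A.ρ x.snd y.fst + f (x.snd, y.snd) := rfl
@[simp] theorem mul_snd (x y : CocycleExtension f) : (x * y).snd = x.snd * y.snd := rfl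
@[simp] theorem one_fst : (1 : CocycleExtension f).fst = -f (1, 1) := rfl
@[simp] theorem one_snd : (1 : CocycleExtension f).snd = 1 := rfl
@[simp] theorem inv_fst (x : CocycleExtension f) :
    x⁻¹.fst = -f (1, 1) - A.ρ x.snd⁻¹ x.fst - f (x.snd⁻¹, x.snd) := rfl
@[simp] theorem inv_snd (x : CocycleExtension f) : x⁻¹.snd = x.snd⁻¹ := rfl

instance : Group (CocycleExtension f) :=
  Group.ofLeftAxioms
    (fun x y z => by
      ext
      · have h := cocycle_rel f x.snd y.snd z.snd
        simp only [mul_fst, mul_snd, map_add, map_mul, Module.End.mul_apply]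
        rw [← sub_eq_zero] at h ⊢
        rw [← h]
        abel
      · exact mul_assoc _ _ _)
    (fun x => by
      ext
      · have h := cocycle_rel f 1 1 x.snd
        simp only [one_mul, map_one, Module.End.one_apply, add_right_inj] at h
        simp [h]
      · exact one_mul _)
    (fun x => by
      ext
      · simp only [mul_fst, inv_fst, inv_snd, one_fst]
        abel
      · exact inv_mul_cancel _)

/-- The projection of the extension onto the quotient. -/
def proj (f : cocycles₂ A) : CocycleExtension f →* G where
  toFun := snd
  map_one' := rfl
  map_mul' _ _ := rfl

theorem mem_coboundaries₂_of_section (s : G →* CocycleExtension f)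
    (hs : (proj f).comp s = MonoidHom.id G) : ⇑f ∈ coboundaries₂ A := by
  have hs_snd (g : G) : (s g).snd = g := DFunLike.congr_fun hs g
  refine ⟨fun g => -(s g).fst, funext fun ⟨g, h⟩ => ?_⟩
  have key := congrArg fst (s.map_mul g h)
  simp only [mul_fst, hs_snd] at key
  simp only [d₁₂_hom_apply, key, map_neg]
  abel

theorem pow_eq (g : G) (n : ℕ) :
    (⟨0, g⟩ : CocycleExtension f) ^ n =
      ⟨-f (1, 1) + ∑ i ∈ Finset.range n, f (g ^ i, g), g ^ n⟩ := by
  induction n with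
  | zero => ext <;> simp
  | succ n ih =>
    rw [pow_succ, ih]
    ext
    · simp [Finset.sum_range_succ, add_assoc]
    · simp [pow_succ]

end CocycleExtension

section Dihedral

variable {k G : Type u} [CommRing k] [Group G] (A : Rep.{u} k G)

/-- The values, in the extension defined by a 2-cocycle, of the relators `a ^ n`, `b ^ 2`,
`(b * a) ^ 2`, measured relative to the identity element. -/
noncomputable def dihedralRelators (a b : G) (n : ℕ) : cocycles₂ A →ₗ[k] Fin 3 → A.V :=
  let ev (x : G × G) : cocycles₂ A →ₗ[k] A.V := LinearMap.proj x ∘ₗ (cocycles₂ A).subtype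
  LinearMap.pi ![∑ i ∈ Finset.range n, ev (a ^ i, a), ev (b, b) + ev (1, 1),
    ev (b, a) + A.ρ (b * a) ∘ₗ ev (b, a) + ev (b * a, b * a) + ev (1, 1)]

theorem mem_coboundaries₂_of_dihedralRelators_eq_zero {n : ℕ} (e : G ≃* DihedralGroup n)
    (f : cocycles₂ A)
    (hf : dihedralRelators A (e.symm (.r 1)) (e.symm (.sr 0)) n f = 0) :
    ⇑f ∈ coboundaries₂ A := by
  set a := e.symm (.r 1) with ha
  set b := e.symm (.sr 0) with hb
  have han : a ^ n = 1 := by rw [ha, ← map_pow, DihedralGroup.r_one_pow_n, map_one]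
  have hbb : b * b = 1 := by rw [hb, ← map_mul, DihedralGroup.sr_mul_self, map_one]
  have hab : b * a * (b * a) = 1 := by
    rw [ha, hb, ← map_mul, ← map_mul, DihedralGroup.sr_mul_r, DihedralGroup.sr_mul_self, map_one]
  have h₀ : ∑ i ∈ Finset.range n, f (a ^ i, a) = 0 := by
    simpa [dihedralRelators] using! congrFun hf 0
  have h₁ : f (b, b) + f (1, 1) = 0 := congrFun hf 1
  have h₂ : f (b, a) + A.ρ (b * a) (f (b, a)) + f (b * a, b * a) + f (1, 1) = 0 := congrFun hf 2
  obtain ⟨φ, hφa, hφb⟩ := DihedralGroup.exists_hom_of_relations (n := n)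
    (⟨0, a⟩ : CocycleExtension f) ⟨0, b⟩
    (by rw [CocycleExtension.pow_eq]; ext <;> simp [h₀, han])
    (by ext <;> simp [eq_neg_of_add_eq_zero_left h₁, hbb])
    (by ext <;> simp [← eq_neg_of_add_eq_zero_left h₂, hab])
  have hφ (x : DihedralGroup n) : (φ x).snd = e.symm x := by
    have hr (i : ZMod n) : (φ (.r i)).snd = e.symm (.r i) := by
      obtain ⟨i, rfl⟩ := ZMod.intCast_surjective i
      rw [← DihedralGroup.r_one_zpow, map_zpow, map_zpow, hφa]
      exact map_zpow (CocycleExtension.proj f) _ _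
    cases x with
    | r i => exact hr i
    | sr i =>
      rw [← zero_add i, ← DihedralGroup.sr_mul_r, map_mul, map_mul, hφb, ← hr]
      rfl
  exact CocycleExtension.mem_coboundaries₂_of_section (φ.comp e.toMonoidHom)
    (MonoidHom.ext fun g => (hφ (e g)).trans (e.symm_apply_apply g))

end Dihedral

section Field

variable {k G : Type u} [Field k] [Group G]

theorem finite_and_finrank_H2_le_of_dihedral {n : ℕ} (e : G ≃* DihedralGroup n)
    (A : Rep.{u} k G) [FiniteDimensional k A.V] :
    Module.Finite k (groupCohomology A 2) ∧
      Module.finrank k (groupCohomology A 2) ≤ 3 * Module.finrank k A.V := by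
  have hsurj : Function.Surjective (H2π A).hom := (ModuleCat.epi_iff_surjective _).1 inferInstance
  obtain ⟨s, hs⟩ := (H2π A).hom.exists_rightInverse_of_surjective
    (LinearMap.range_eq_top.2 hsurj)
  have hinj : Function.Injective
      (dihedralRelators A (e.symm (.r 1)) (e.symm (.sr 0)) n ∘ₗ s) := by
    rw [injective_iff_map_eq_zero]
    intro x hx
    have h := (H2π_eq_zero_iff (s x)).2 (mem_coboundaries₂_of_dihedralRelators_eq_zero A e _ hx)
    exact (LinearMap.congr_fun hs x).symm.trans h
  refine ⟨Module.Finite.of_injective _ hinj, ?_⟩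
  simpa [Module.finrank_pi_fintype] using LinearMap.finrank_le_finrank_of_injective hinj

/-- The term `x • φ x⁻¹` of the transfer map depends only on the left coset of `x`. -/
theorem coind_term_eq_of_mk_eq (S : Subgroup G) (M : Rep.{u} k G)
    (φ : Rep.coind S.subtype (Rep.res S.subtype M)) {x y : G} (h : (x : G ⧸ S) = y) :
    M.ρ x (φ.1 x⁻¹) = M.ρ y (φ.1 y⁻¹) := by
  have hφ : φ.1 y⁻¹ = M.ρ (y⁻¹ * x) (φ.1 x⁻¹) := by
    have hmem : y⁻¹ * x ∈ S := QuotientGroup.eq.1 h.symm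
    have := φ.2 ⟨y⁻¹ * x, hmem⟩ x⁻¹
    simpa using this
  rw [hφ, ← Module.End.mul_apply, ← map_mul, mul_inv_cancel_left]

/-- The transfer map `∑ x, x • φ x⁻¹` from the coinduction of the restriction of `M` back to `M`,
where `x` runs over representatives of the left cosets of `S`. -/
noncomputable def coindTransfer (S : Subgroup G) [Fintype (G ⧸ S)] (M : Rep.{u} k G) :
    Rep.coind S.subtype (Rep.res S.subtype M) ⟶ M :=
  let t : Rep.coind S.subtype (Rep.res S.subtype M) →ₗ[k] M.V :=
    ∑ c : G ⧸ S, M.ρ c.out ∘ₗ LinearMap.proj c.out⁻¹ ∘ₗ Submodule.subtype _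
  Rep.ofHom ⟨t, fun h => LinearMap.ext fun φ => by
    have ht (ψ : Rep.coind S.subtype (Rep.res S.subtype M)) :
        t ψ = ∑ c : G ⧸ S, M.ρ c.out (ψ.1 c.out⁻¹) := by
      simp [t]
    simp only [LinearMap.comp_apply]
    rw [ht, ht, map_sum]
    refine Fintype.sum_equiv (MulAction.toPerm h⁻¹) _ _ fun c => ?_
    have hc : ((h⁻¹ * c.out : G) : G ⧸ S) = ((h⁻¹ • c).out : G) := by
      rw [QuotientGroup.out_eq', ← smul_eq_mul, ← MulAction.Quotient.smul_coe,
        QuotientGroup.out_eq']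
    rw [MulAction.toPerm_apply, ← coind_term_eq_of_mk_eq S M φ hc, ← Module.End.mul_apply,
      ← map_mul, mul_inv_cancel_left, mul_inv_rev, inv_inv]
    rfl⟩

theorem resCoindToHom_comp_coindTransfer (S : Subgroup G) [Fintype (G ⧸ S)] (M : Rep.{u} k G) :
    Rep.resCoindToHom S.subtype M (Rep.res S.subtype M) (𝟙 _) ≫ coindTransfer S M =
      (S.index : k) • 𝟙 M := by
  ext x
  change _ = (S.index : k) • x
  simp [coindTransfer, Subgroup.index_eq_card, Nat.cast_smul_eq_nsmul]

theorem isSplitMono_resCoindToHom (S : Subgroup G) [S.FiniteIndex] (hS : (S.index : k) ≠ 0)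
    (M : Rep.{u} k G) :
    IsSplitMono (Rep.resCoindToHom S.subtype M (Rep.res S.subtype M) (𝟙 _)) := by
  have := Fintype.ofFinite (G ⧸ S)
  exact ⟨⟨(S.index : k)⁻¹ • coindTransfer S M, by
    rw [Linear.comp_smul, resCoindToHom_comp_coindTransfer, smul_smul, inv_mul_cancel₀ hS,
      one_smul]⟩⟩

/-- If the index of `S` is invertible in `k`, the cohomology of `G` embeds into that of `S`. -/
theorem exists_injective_groupCohomology_subgroup (S : Subgroup G) [S.FiniteIndex]
    (hS : (S.index : k) ≠ 0) (M : Rep.{u} k G) (n : ℕ) :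
    ∃ φ : groupCohomology M n →ₗ[k] groupCohomology (Rep.res S.subtype M) n,
      Function.Injective φ := by
  have := isSplitMono_resCoindToHom S hS M
  let ι := (groupCohomology.functor k G n).map
    (Rep.resCoindToHom S.subtype M (Rep.res S.subtype M) (𝟙 _))
  have hι : Function.Injective ι.hom := (ModuleCat.mono_iff_injective ι).1 inferInstance
  let e := (groupCohomology.coindIso (Rep.res S.subtype M) n).toLinearEquiv
  exact ⟨e.toLinearMap ∘ₗ ι.hom, e.injective.comp hι⟩

end Field

/-- Let `F` be a field of characteristic `2`, and let `Q` be a finite group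
whose Sylow `2`-subgroup is isomorphic to the dihedral group of order `2^(m+1)` for some
`m ≥ 1` (i.e. to `DihedralGroup (2^m)`).  Then for every finite-dimensional `F`-linear
representation `M` of `Q`, `dim_F H^2(Q, M) ≤ 3 · dim_F M`. -/
theorem finrank_groupCohomology_two_le_of_dihedral_sylow
    (F : Type) [Field F] [CharP F 2]
    (Q : Type) [Group Q] [Fintype Q]
    (m : ℕ) (hm : 1 ≤ m) (P : Sylow 2 Q)
    (hP : Nonempty (↥(P : Subgroup Q) ≃* DihedralGroup (2 ^ m)))
    (M : Rep F Q) [FiniteDimensional F M.V] :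
    Module.finrank F (groupCohomology M 2) ≤ 3 * Module.finrank F M.V := by
  obtain ⟨e⟩ := hP
  have hindex : ((P : Subgroup Q).index : F) ≠ 0 := by
    rw [Ne, CharP.cast_eq_zero_iff F 2]
    exact P.not_dvd_index
  obtain ⟨φ, hφ⟩ := exists_injective_groupCohomology_subgroup (P : Subgroup Q) hindex M 2
  have : FiniteDimensional F (Rep.res (P : Subgroup Q).subtype M).V :=
    inferInstanceAs (FiniteDimensional F M.V)
  obtain ⟨_, hle⟩ := finite_and_finrank_H2_le_of_dihedral e
    (Rep.res (P : Subgroup Q).subtype M)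
  exact (LinearMap.finrank_le_finrank_of_injective hφ).trans hle
end

section
/- Let p be a prime and Q a finite group. There are only finitely many isomorphism classes of indecomposable finite-dimensional 𝔽_p-linear representations of Q if and only if the Sylow p-subgroups of Q are cyclic; moreover, when the Sylow p-subgroups of Q are cyclic, there is a finite family of at most |Q| indecomposable finite-dimensional 𝔽_p-linear representations of Q such that every indecomposable finite-dimensional 𝔽_p-linear representation of Q is isomorphic to a member of the family. -/
namespace Representation

section Retract

variable {k : Type*} [Field k] {G H V W : Type*} [Group G] [Group H]
  [AddCommGroup V] [Module k V] [AddCommGroup W] [Module k W]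

/-- The endomorphisms of `σ` satisfy the weak form of locality: if a sum of two of them is
injective, then so is one of the summands. -/
def HasLocalEnd (σ : Representation k H W) : Prop :=
  ∀ φ ψ : Module.End k W, (∀ h, Commute φ (σ h)) → (∀ h, Commute ψ (σ h)) →
    Function.Injective ⇑(φ + ψ) → Function.Injective φ ∨ Function.Injective ψ

/-- There are `H`-equivariant maps `W → V → W` with injective composite, where `V` carries the
action of `H` restricted along `f : H →* G`. For finite-dimensional `W` this says that `σ` is a
direct summand of the restriction of `ρ`. -/
def IsRetractAlong (f : H →* G) (σ : Representation k H W) (ρ : Representation k G V) : Prop :=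
  ∃ (α : W →ₗ[k] V) (β : V →ₗ[k] W), (∀ h w, α (σ h w) = ρ (f h) (α w)) ∧
    (∀ h v, β (ρ (f h) v) = σ h (β v)) ∧ Function.Injective (β ∘ₗ α)

theorem IsRetractAlong.finrank_le {f : H →* G} {σ : Representation k H W}
    {ρ : Representation k G V} [FiniteDimensional k V] (h : IsRetractAlong f σ ρ) :
    Module.finrank k W ≤ Module.finrank k V := by
  obtain ⟨α, β, -, -, hi⟩ := h
  rw [LinearMap.coe_comp] at hi
  exact LinearMap.finrank_le_finrank_of_injective hi.of_comp

theorem IsRetractAlong.trans_equiv {V' : Type*} [AddCommGroup V'] [Module k V'] {f : H →* G}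
    {σ : Representation k H W} {ρ : Representation k G V} {ρ' : Representation k G V'}
    (h : IsRetractAlong f σ ρ) (E : ρ.Equiv ρ') : IsRetractAlong f σ ρ' := by
  obtain ⟨α, β, hα, hβ, hi⟩ := h
  have hE : ∀ g v, E.toLinearEquiv (ρ g v) = ρ' g (E.toLinearEquiv v) := fun g v =>
    E.toIntertwiningMap.isIntertwining _ _ g v
  have hE' : ∀ g v, E.toLinearEquiv.symm (ρ' g v) = ρ g (E.toLinearEquiv.symm v) := fun g v =>
    E.toLinearEquiv.symm_apply_eq.2 (by rw [hE, LinearEquiv.apply_symm_apply])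
  refine ⟨E.toLinearEquiv.toLinearMap ∘ₗ α, β ∘ₗ E.toLinearEquiv.symm.toLinearMap, fun h w => ?_,
    fun h v => ?_, ?_⟩
  · exact (congrArg E.toLinearEquiv (hα h w)).trans (hE _ _)
  · exact (congrArg β (hE' (f h) v)).trans (hβ h _)
  · convert hi using 2
    exact LinearMap.ext fun w => congrArg β (E.toLinearEquiv.symm_apply_apply (α w))

theorem HasLocalEnd.exists_injective_of_sum {σ : Representation k H W} [Nontrivial W]
    (hσ : σ.HasLocalEnd) {ι : Type*} (s : Finset ι) (φ : ι → Module.End k W)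
    (hφ : ∀ i h, Commute (φ i) (σ h)) (hs : Function.Injective ⇑(∑ i ∈ s, φ i)) :
    ∃ i ∈ s, Function.Injective (φ i) := by
  classical
  induction s using Finset.induction_on with
  | empty =>
    obtain ⟨x, hx⟩ := exists_ne (0 : W)
    exact absurd (hs (by simp : _ = (∑ i ∈ ∅, φ i) 0)) hx
  | insert a s ha ih =>
    rw [Finset.sum_insert ha] at hs
    rcases hσ _ _ (hφ a) (fun h => Commute.sum_left _ _ _ fun i _ => hφ i h) hs with h | h
    · exact ⟨a, by simp, h⟩
    · obtain ⟨i, hi, hi'⟩ := ih h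
      exact ⟨i, by simp [hi], hi'⟩

theorem projection_commute {ρ : Representation k G V} {U U' : Submodule k V} (h : IsCompl U U')
    (hU : ∀ g, ∀ x ∈ U, ρ g x ∈ U) (hU' : ∀ g, ∀ x ∈ U', ρ g x ∈ U') (g : G) (v : V) :
    U.projection U' h (ρ g v) = ρ g (U.projection U' h v) := by
  conv_lhs => rw [← Submodule.projection_add_projection_eq_self h v]
  rw [map_add, map_add,
    Submodule.projection_apply_of_mem_left h (hU g _ (Submodule.projection_apply_mem h v)),
    (Submodule.projection_apply_eq_zero_iff h).2
      (hU' g _ (Submodule.projection_apply_mem h.symm v)), add_zero]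

theorem IsRetractAlong.of_projection {f : H →* G} {σ : Representation k H W}
    {ρ : Representation k G V} {U U' : Submodule k V} (h : IsCompl U U')
    (hU : ∀ g, ∀ x ∈ U, ρ g x ∈ U) (hU' : ∀ g, ∀ x ∈ U', ρ g x ∈ U')
    {α : W →ₗ[k] V} {β : V →ₗ[k] W} (hα : ∀ h w, α (σ h w) = ρ (f h) (α w))
    (hβ : ∀ h v, β (ρ (f h) v) = σ h (β v))
    (hi : Function.Injective (β ∘ₗ U.projection U' h ∘ₗ α)) :
    IsRetractAlong f σ (Subrepresentation.toRepresentation (ρ := ρ) ⟨U, fun g x => hU g x⟩) := by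
  refine ⟨U.projectionOnto U' h ∘ₗ α, β ∘ₗ U.subtype, fun g w => ?_, fun g v => hβ g v, hi⟩
  ext
  simp only [LinearMap.comp_apply, hα, Submodule.coe_projectionOnto_apply,
    projection_commute h hU hU']
  rfl

theorem IsRetractAlong.of_isCompl {f : H →* G} {σ : Representation k H W}
    {ρ : Representation k G V} (hσ : σ.HasLocalEnd) (hr : IsRetractAlong f σ ρ)
    {U U' : Submodule k V} (h : IsCompl U U')
    (hU : ∀ g, ∀ x ∈ U, ρ g x ∈ U) (hU' : ∀ g, ∀ x ∈ U', ρ g x ∈ U') :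
    IsRetractAlong f σ (Subrepresentation.toRepresentation (ρ := ρ) ⟨U, fun g x => hU g x⟩) ∨
    IsRetractAlong f σ (Subrepresentation.toRepresentation (ρ := ρ) ⟨U', fun g x => hU' g x⟩) := by
  obtain ⟨α, β, hα, hβ, hi⟩ := hr
  have key := hσ (β ∘ₗ U.projection U' h ∘ₗ α) (β ∘ₗ U'.projection U h.symm ∘ₗ α)
    (fun g => by ext w; simp [hα, hβ, projection_commute h hU hU'])
    (fun g => by ext w; simp [hα, hβ, projection_commute h.symm hU' hU]) (by
      convert hi using 2
      rw [← LinearMap.comp_add, ← LinearMap.add_comp,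
        Submodule.projection_add_projection_eq_id h, LinearMap.id_comp])
  exact key.imp (IsRetractAlong.of_projection h hU hU' hα hβ)
    (IsRetractAlong.of_projection h.symm hU' hU hα hβ)

end Retract

end Representation

namespace Rep

open Representation

universe w w'

section Indecomposable

variable {k : Type} [Field k] {G : Type} [Group G]

theorem Indecomposable.isUnit_or_isNilpotent {M : Rep.{w} k G} [FiniteDimensional k M.V]
    (hM : M.Indecomposable) (φ : Module.End k M.V) (hφ : ∀ g, Commute φ (M.ρ g)) :
    IsUnit φ ∨ IsNilpotent φ := by
  obtain ⟨n, hn, hn0⟩ := (φ.eventually_isCompl_ker_pow_range_pow.and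
    (Filter.eventually_ge_atTop 1)).exists
  have hc : ∀ g x, (φ ^ n) (M.ρ g x) = M.ρ g ((φ ^ n) x) := fun g x =>
    LinearMap.congr_fun ((hφ g).pow_left n).eq x
  rcases hM.2 _ _ (fun g x hx => by
      rw [LinearMap.mem_ker] at hx ⊢
      rw [hc, hx, map_zero])
    (by
      rintro g _ ⟨x, rfl⟩
      exact ⟨M.ρ g x, hc g x⟩) hn.inf_eq_bot hn.sup_eq_top with h | h
  · left
    rw [← isUnit_pow_iff (n := n) (by omega)]
    exact (LinearMap.isUnit_iff_ker_eq_bot _).2 h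
  · exact Or.inr ⟨n, LinearMap.range_eq_bot.1 h⟩

theorem Indecomposable.hasLocalEnd {M : Rep.{w} k G} [FiniteDimensional k M.V]
    (hM : M.Indecomposable) : M.ρ.HasLocalEnd := by
  intro φ ψ hφ hψ hi
  obtain ⟨u, hu⟩ := (LinearMap.isUnit_iff_ker_eq_bot (φ + ψ)).2 (LinearMap.ker_eq_bot.2 hi)
  have hug : ∀ g, Commute (↑u⁻¹ : Module.End k M.V) (M.ρ g) := fun g =>
    Commute.units_inv_left (hu ▸ (hφ g).add_left (hψ g))
  have hadd : (↑u⁻¹ : Module.End k M.V) * ψ = 1 - ↑u⁻¹ * φ := by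
    rw [eq_sub_iff_add_eq, ← mul_add, add_comm ψ, ← hu, Units.inv_mul]
  have inj : ∀ χ : Module.End k M.V, IsUnit (↑u⁻¹ * χ) → Function.Injective χ := fun χ h =>
    LinearMap.ker_eq_bot.1 ((LinearMap.isUnit_iff_ker_eq_bot χ).1 ((Units.isUnit_units_mul _ _).1 h))
  rcases hM.isUnit_or_isNilpotent (↑u⁻¹ * φ) (fun g => (hug g).mul_left (hφ g)) with h | h
  · exact Or.inl (inj _ h)
  · exact Or.inr (inj _ (hadd ▸ h.isUnit_one_sub))

/-- The subrepresentation of `X` on an invariant subspace. -/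
abbrev ofInvariant (X : Rep.{w} k G) (U : Submodule k X.V) (hU : ∀ g, ∀ x ∈ U, X.ρ g x ∈ U) :
    Rep.{w} k G :=
  Rep.of (Subrepresentation.toRepresentation (ρ := X.ρ) ⟨U, fun g x => hU g x⟩)

theorem exists_isCompl_of_not_indecomposable {X : Rep.{w} k G} [Nontrivial X.V]
    [FiniteDimensional k X.V] (hX : ¬ X.Indecomposable) :
    ∃ (U U' : Submodule k X.V), IsCompl U U' ∧ (∀ g, ∀ x ∈ U, X.ρ g x ∈ U) ∧
      (∀ g, ∀ x ∈ U', X.ρ g x ∈ U') ∧ Module.finrank k U < Module.finrank k X.V ∧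
      Module.finrank k U' < Module.finrank k X.V := by
  unfold Indecomposable at hX
  push Not at hX
  obtain ⟨U, U', hU, hU', hinf, hsup, h1, h2⟩ := hX ‹_›
  have hc : IsCompl U U' := IsCompl.of_eq hinf hsup
  have := Submodule.finrank_add_eq_of_isCompl hc
  have p1 := Submodule.one_le_finrank_iff.2 h1
  have p2 := Submodule.one_le_finrank_iff.2 h2
  exact ⟨U, U', hc, hU, hU', by omega, by omega⟩

theorem exists_indecomposable_of_isRetractAlong {H W : Type*} [Group H] [AddCommGroup W]
    [Module k W] [Nontrivial W] {f : H →* G} {σ : Representation k H W} (hσ : σ.HasLocalEnd)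
    (X : Rep.{w} k G) [FiniteDimensional k X.V] (hX : IsRetractAlong f σ X.ρ) :
    ∃ M : Rep.{w} k G, FiniteDimensional k M.V ∧ M.Indecomposable ∧
      Module.finrank k W ≤ Module.finrank k M.V := by
  induction hn : Module.finrank k X.V using Nat.strong_induction_on generalizing X with
  | _ n ih =>
  subst hn
  have : Nontrivial X.V := by
    obtain ⟨α, β, -, -, hi⟩ := hX
    rw [LinearMap.coe_comp] at hi
    exact hi.of_comp.nontrivial
  by_cases hind : X.Indecomposable
  · exact ⟨X, inferInstance, hind, hX.finrank_le⟩
  · obtain ⟨U, U', hc, hU, hU', h1, h2⟩ := exists_isCompl_of_not_indecomposable hind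
    rcases hX.of_isCompl hσ hc hU hU' with h | h
    · exact ih _ h1 (X.ofInvariant U hU) h rfl
    · exact ih _ h2 (X.ofInvariant U' hU') h rfl

theorem equiv_of_isRetractAlong {M : Rep.{w} k G} {X : Rep.{w'} k G} [FiniteDimensional k M.V]
    [FiniteDimensional k X.V] [Nontrivial M.V] (hX : X.Indecomposable)
    (h : IsRetractAlong (.id G) M.ρ X.ρ) : Nonempty (M.ρ.Equiv X.ρ) := by
  obtain ⟨α, β, hα, hβ, hi⟩ := h
  have hu : IsUnit (β ∘ₗ α : Module.End k M.V) :=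
    (LinearMap.isUnit_iff_ker_eq_bot _).2 (LinearMap.ker_eq_bot.2 hi)
  have hbij : Function.Bijective β := by
    rcases hX.isUnit_or_isNilpotent (α ∘ₗ β)
      (fun g => LinearMap.ext fun x => (congrArg α (hβ g x)).trans (hα g (β x))) with h | ⟨n, hn⟩
    · have h1 := (Module.End.isUnit_iff _).1 h
      have h2 := (Module.End.isUnit_iff _).1 hu
      rw [LinearMap.coe_comp] at h1 h2
      exact ⟨h1.1.of_comp, h2.2.of_comp⟩
    · exfalso
      have hpow : ∀ m, (β ∘ₗ α : Module.End k M.V) ^ (m + 1) = β ∘ₗ ((α ∘ₗ β) ^ m) ∘ₗ α := by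
        intro m
        induction m with
        | zero => simp [Module.End.one_eq_id]
        | succ m ih =>
          rw [pow_succ, ih, pow_succ]
          rfl
      refine (hu.pow (n + 1)).ne_zero ?_
      rw [hpow, hn]
      simp
  exact ⟨(Representation.Equiv.mk (LinearEquiv.ofBijective β hbij)
    (fun g => by ext x; exact hβ g x)).symm⟩

/-- Krull–Schmidt bookkeeping: up to isomorphism, the indecomposable summands of `X` of dimension
at least `e` can be listed with at most `dim X / e` entries. -/
theorem exists_list_of_isRetractAlong (X : Rep.{w} k G) [FiniteDimensional k X.V] (e : ℕ)
    (he : 0 < e) :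
    ∃ L : List (Rep.{w} k G), L.length * e ≤ Module.finrank k X.V ∧
      ∀ M : Rep.{w'} k G, FiniteDimensional k M.V → M.Indecomposable → e ≤ Module.finrank k M.V →
        IsRetractAlong (.id G) M.ρ X.ρ → ∃ Y ∈ L, Nonempty (M.ρ.Equiv Y.ρ) := by
  induction hn : Module.finrank k X.V using Nat.strong_induction_on generalizing X with
  | _ n ih =>
  subst hn
  by_cases hlt : Module.finrank k X.V < e
  · exact ⟨[], by simp, fun M _ _ hM h => by have := h.finrank_le; omega⟩
  have : Nontrivial X.V := Module.finrank_pos_iff.1 (by omega : 0 < Module.finrank k X.V)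
  by_cases hind : X.Indecomposable
  · refine ⟨[X], by simpa using hlt, fun M _ hM _ h => ⟨X, by simp, ?_⟩⟩
    have := hM.1
    exact equiv_of_isRetractAlong hind h
  · obtain ⟨U, U', hc, hU, hU', h1, h2⟩ := exists_isCompl_of_not_indecomposable hind
    obtain ⟨L, hL, hL'⟩ := ih _ h1 (X.ofInvariant U hU) rfl
    obtain ⟨L₂, hL₂, hL₂'⟩ := ih _ h2 (X.ofInvariant U' hU') rfl
    refine ⟨L ++ L₂, ?_, fun M hfd hM hle h => ?_⟩
    · rw [List.length_append, add_mul, ← Submodule.finrank_add_eq_of_isCompl hc]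
      exact add_le_add hL hL₂
    · rcases h.of_isCompl hM.hasLocalEnd hc hU hU' with h | h
      · obtain ⟨Y, hY, hY'⟩ := hL' M hfd hM hle h
        exact ⟨Y, by simp [hY], hY'⟩
      · obtain ⟨Y, hY, hY'⟩ := hL₂' M hfd hM hle h
        exact ⟨Y, by simp [hY], hY'⟩

end Indecomposable

end Rep

namespace Representation

section Trace

variable {k : Type*} [CommSemiring k] {G V W : Type*} [Group G]
  [AddCommMonoid V] [Module k V] [AddCommMonoid W] [Module k W]

/-- The relative trace of a linear map `F` from a subgroup `P` of finite index to `G`. -/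
noncomputable def relTrace (ρ : Representation k G V) (σ : Representation k G W) (P : Subgroup G)
    [Fintype (G ⧸ P)] (F : V →ₗ[k] W) : V →ₗ[k] W :=
  ∑ c : G ⧸ P, σ c.out ∘ₗ F ∘ₗ ρ c.out⁻¹

theorem relTrace_comm (ρ : Representation k G V) (σ : Representation k G W) (P : Subgroup G)
    [Fintype (G ⧸ P)] (F : V →ₗ[k] W) (hF : ∀ h ∈ P, ∀ v, F (ρ h v) = σ h (F v)) (g : G) (v : V) :
    relTrace ρ σ P F (ρ g v) = σ g (relTrace ρ σ P F v) := by
  have hout : ∀ (c : G ⧸ P) (v : V), σ (g • c).out (F (ρ (g • c).out⁻¹ v)) =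
      σ (g * c.out) (F (ρ (g * c.out)⁻¹ v)) := by
    intro c v
    obtain ⟨h, hh⟩ := QuotientGroup.mk_out_eq_mul P (g * c.out)
    have hc : g • c = ((g * c.out : G) : G ⧸ P) := by
      conv_lhs => rw [← QuotientGroup.out_eq' c]
      rfl
    rw [hc, hh, mul_inv_rev, map_mul, map_mul, Module.End.mul_apply, Module.End.mul_apply,
      ← hF _ h.2, ← Module.End.mul_apply (ρ _), ← map_mul, mul_inv_cancel_left]
    rfl
  simp only [relTrace, LinearMap.sum_apply, LinearMap.comp_apply, map_sum]
  rw [← Equiv.sum_comp (MulAction.toPerm g : Equiv.Perm (G ⧸ P))]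
  refine Finset.sum_congr rfl fun c _ => ?_
  rw [MulAction.toPerm_apply, hout, mul_inv_rev, map_mul, map_mul]
  simp only [Module.End.mul_apply]
  simp

end Trace

end Representation

namespace Rep

open Representation
open scoped MonoidAlgebra

universe w w'

section ULift

variable {k : Type} [Field k] {G : Type} [Group G]

/-- Universe lift of a representation. -/
def ulift (X : Rep.{w} k G) : Rep.{max w w'} k G :=
  Rep.of (X := ULift.{w'} X.V)
    { toFun g := ULift.moduleEquiv.symm.toLinearMap ∘ₗ X.ρ g ∘ₗ ULift.moduleEquiv.toLinearMap
      map_one' := by ext; simp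
      map_mul' g h := by ext; simp }

/-- A representation is equivalent to its universe lift. -/
def uliftEquiv (X : Rep.{w} k G) : X.ρ.Equiv (ulift.{w, w'} X).ρ :=
  Representation.Equiv.mk ULift.moduleEquiv.symm (fun g => by ext; rfl)

end ULift

section CyclicQuotient

variable {k : Type} [Field k] {G : Type} [Group G]

/-- The quotient of the group algebra by the left ideal generated by `(x - 1) ^ e`. -/
noncomputable def cyclicQuotient (k : Type) [Field k] {G : Type} [Group G] (x : G) (e : ℕ) :
    Rep.{0} k G :=
  Rep.of (Representation.ofModule' (k := k) (G := G)
    (k[G] ⧸ Submodule.span k[G] {(MonoidAlgebra.single x (1 : k) - 1) ^ e}))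

/-- The class of `a` in the quotient of the group algebra. -/
noncomputable def cyclicQuotient.mk (x : G) (e : ℕ) : k[G] →ₗ[k] (cyclicQuotient k x e).V :=
  (Submodule.mkQ (Submodule.span k[G] {(MonoidAlgebra.single x (1 : k) - 1) ^ e})).restrictScalars k

theorem cyclicQuotient.mk_surjective (x : G) (e : ℕ) :
    Function.Surjective (cyclicQuotient.mk (k := k) x e) :=
  Submodule.mkQ_surjective
    (Submodule.span k[G] {(MonoidAlgebra.single x (1 : k) - 1) ^ e})

theorem cyclicQuotient.mk_eq_zero (x : G) (e : ℕ) (a : k[G]) :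
    cyclicQuotient.mk x e (a * (MonoidAlgebra.single x (1 : k) - 1) ^ e) = 0 :=
  (Submodule.Quotient.mk_eq_zero _).2 (Submodule.mem_span_singleton.2 ⟨a, rfl⟩)

theorem cyclicQuotient.ρ_mk (x : G) (e : ℕ) (g : G) (a : k[G]) :
    (cyclicQuotient k x e).ρ g (cyclicQuotient.mk x e a) =
      cyclicQuotient.mk x e (MonoidAlgebra.single g 1 * a) := rfl

instance [Finite G] (x : G) (e : ℕ) : FiniteDimensional k (cyclicQuotient k x e).V :=
  Module.Finite.of_surjective _ (cyclicQuotient.mk_surjective x e)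

theorem finrank_cyclicQuotient_le [Finite G] (P : Subgroup G) (x : G)
    (hP : ∀ h ∈ P, ∃ n : ℕ, x ^ n = h) (e : ℕ) :
    Module.finrank k (cyclicQuotient k x e).V ≤ e * P.index := by
  classical
  have := Fintype.ofFinite (G ⧸ P)
  let y : k[G] := MonoidAlgebra.single x (1 : k) - 1
  let b : (G ⧸ P) × Fin e → (cyclicQuotient k x e).V := fun c =>
    cyclicQuotient.mk x e (MonoidAlgebra.single c.1.out 1 * y ^ (c.2 : ℕ))
  have hb : Submodule.span k (Set.range b) = ⊤ := by
    have hterm : ∀ (c : G ⧸ P) (j : ℕ),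
        cyclicQuotient.mk x e (MonoidAlgebra.single c.out (1 : k) * y ^ j) ∈
          Submodule.span k (Set.range b) := by
      intro c j
      by_cases hj : j < e
      · exact Submodule.subset_span ⟨(c, ⟨j, hj⟩), rfl⟩
      · rw [← Nat.sub_add_cancel (not_lt.1 hj), pow_add, ← mul_assoc, cyclicQuotient.mk_eq_zero]
        exact zero_mem _
    rw [eq_top_iff, ← LinearMap.range_eq_top.2 (cyclicQuotient.mk_surjective (k := k) x e),
      LinearMap.range_eq_map, Submodule.map_le_iff_le_comap]
    intro a _
    induction a using MonoidAlgebra.induction_linear with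
    | zero => exact zero_mem _
    | add u v hu hv => exact add_mem (hu Submodule.mem_top) (hv Submodule.mem_top)
    | single g r =>
      obtain ⟨h, hh⟩ := QuotientGroup.mk_out_eq_mul P g
      obtain ⟨n, hn⟩ := hP _ (inv_mem h.2)
      have hg : MonoidAlgebra.single g r =
          r • (MonoidAlgebra.single (g : G ⧸ P).out (1 : k) * (y + 1) ^ n) := by
        rw [sub_add_cancel, MonoidAlgebra.single_pow, MonoidAlgebra.single_mul_single, hn, hh]
        simp
      rw [hg]
      refine Submodule.smul_mem _ r ?_
      rw [Submodule.mem_comap, (Commute.one_right y).add_pow, Finset.mul_sum, map_sum]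
      refine Submodule.sum_mem _ fun j _ => ?_
      rw [one_pow, mul_one, ← nsmul_eq_mul', mul_smul_comm, map_nsmul]
      exact Submodule.smul_of_tower_mem _ _ (hterm _ _)
  have := finrank_range_le_card (R := k) b
  rw [Set.finrank, hb, finrank_top] at this
  rwa [Fintype.card_prod, Fintype.card_fin, mul_comm, ← Nat.card_eq_fintype_card] at this

/-- A vector killed by `(x - 1) ^ e` gives a map out of the cyclic quotient. -/
theorem exists_cyclicQuotient_lift (M : Rep.{w} k G) (x : G) (e : ℕ) (v : M.V)
    (hv : ((M.ρ x - 1) ^ e) v = 0) :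
    ∃ β : (cyclicQuotient k x e).V →ₗ[k] M.V,
      (∀ g y, β ((cyclicQuotient k x e).ρ g y) = M.ρ g (β y)) ∧
      β (cyclicQuotient.mk x e 1) = v := by
  let φ : k[G] →ₗ[k] M.V := (LinearMap.applyₗ v) ∘ₗ M.ρ.asAlgebraHom.toLinearMap
  have hφ : ∀ a, φ a = M.ρ.asAlgebraHom a v := fun _ => rfl
  let β : (cyclicQuotient k x e).V →ₗ[k] M.V := Submodule.liftQ
    ((Submodule.span k[G] {(MonoidAlgebra.single x (1 : k) - 1) ^ e}).restrictScalars k) φ (by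
      intro a ha
      obtain ⟨b, rfl⟩ := Submodule.mem_span_singleton.1 ha
      rw [LinearMap.mem_ker, hφ, smul_eq_mul, map_mul, map_pow, map_sub, map_one,
        Representation.asAlgebraHom_single_one, Module.End.mul_apply, hv, map_zero])
  have hβ : ∀ a, β (cyclicQuotient.mk x e a) = M.ρ.asAlgebraHom a v := fun _ => rfl
  refine ⟨β, fun g y => ?_, by rw [hβ, map_one]; rfl⟩
  obtain ⟨a, rfl⟩ := cyclicQuotient.mk_surjective x e y
  rw [cyclicQuotient.ρ_mk, hβ, hβ, map_mul, Representation.asAlgebraHom_single_one]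
  rfl

end CyclicQuotient

end Rep

namespace Module.AEval'

open Polynomial

theorem aeval_map_of_comm {k V W : Type*} [CommSemiring k] [AddCommMonoid V] [Module k V]
    [AddCommMonoid W] [Module k W] {S : Module.End k V} {T : Module.End k W} (β : V →ₗ[k] W)
    (h : ∀ v, β (S v) = T (β v)) (f : k[X]) (v : V) : β (aeval S f v) = aeval T f (β v) := by
  induction f using Polynomial.induction_on generalizing v with
  | C a => simp
  | add f g hf hg => simp [hf, hg]
  | monomial n a ih =>
    rw [pow_succ, ← mul_assoc, map_mul (aeval S) _ X, map_mul (aeval T) _ X, aeval_X, aeval_X,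
      Module.End.mul_apply, Module.End.mul_apply, ih, h]

theorem smul_of {k V : Type*} [CommSemiring k] [AddCommMonoid V] [Module k V] (S : Module.End k V)
    (f : k[X]) (v : V) : f • of S v = of S (aeval S f v) :=
  (Module.AEval.of_aeval_smul S f v).symm

theorem of_symm_smul {k V : Type*} [CommSemiring k] [AddCommMonoid V] [Module k V]
    (S : Module.End k V) (f : k[X]) (v : Module.AEval' S) :
    (of S).symm (f • v) = aeval S f ((of S).symm v) := by
  obtain ⟨v, rfl⟩ := (of S).surjective v
  rw [smul_of, LinearEquiv.symm_apply_apply, LinearEquiv.symm_apply_apply]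

end Module.AEval'

namespace Rep

open Representation Polynomial
open scoped MonoidAlgebra

universe w

section Cyclic

variable {k : Type} [Field k] {G : Type} [Group G]

theorem sub_one_pow_eq_zero (p : ℕ) [Fact p.Prime] [CharP k p] (M : Rep.{w} k G) (x : G) (a : ℕ)
    (hx : x ^ p ^ a = 1) : (M.ρ x - 1) ^ p ^ a = 0 := by
  have h : (X - 1 : k[X]) ^ p ^ a = X ^ p ^ a - 1 := by
    rw [sub_pow_char_pow, one_pow]
  have := congrArg (aeval (M.ρ x)) h
  rwa [map_pow, map_sub, map_sub, map_pow, aeval_X, map_one, ← map_pow M.ρ, hx, map_one,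
    sub_self] at this

/-- The map from a cyclic `k[X]`-module to the cyclic quotient of the group algebra. -/
theorem exists_cyclicQuotient_map (x : G) (e : ℕ) :
    ∃ γ : (k[X] ⧸ k[X] ∙ (X : k[X]) ^ e) →ₗ[k[X]]
        Module.AEval' ((cyclicQuotient k x e).ρ x - 1),
      γ (Submodule.Quotient.mk 1) = Module.AEval'.of _ (cyclicQuotient.mk x e 1) := by
  refine ⟨Submodule.liftQSpanSingleton _ (LinearMap.toSpanSingleton k[X] _
    (Module.AEval'.of _ (cyclicQuotient.mk x e 1))) ?_, ?_⟩
  · have h : ∀ (n : ℕ) (a : k[G]),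
        (((cyclicQuotient k x e).ρ x - 1) ^ n) (cyclicQuotient.mk x e a) =
        cyclicQuotient.mk x e ((MonoidAlgebra.single x (1 : k) - 1) ^ n * a) := by
      intro n a
      induction n generalizing a with
      | zero => simp
      | succ n ih =>
        rw [pow_succ, Module.End.mul_apply, LinearMap.sub_apply, cyclicQuotient.ρ_mk,
          Module.End.one_apply, ← map_sub, ih, pow_succ, mul_assoc, sub_mul _ _ a, one_mul]
    rw [LinearMap.toSpanSingleton_apply, Module.AEval'.smul_of, map_pow, aeval_X, h, mul_one]
    have := cyclicQuotient.mk_eq_zero (k := k) x e 1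
    rw [one_mul] at this
    rw [this, map_zero]
  · exact one_smul k[X] _

theorem exists_isRetractAlong_cyclicQuotient (p : ℕ) [Fact p.Prime] [CharP k p] [Finite G]
    (P : Subgroup G) (x : G) (hxP : ∀ h ∈ P, ∃ n : ℕ, x ^ n = h) (a : ℕ) (hx : x ^ p ^ a = 1)
    (hindex : (P.index : k) ≠ 0) (M : Rep.{w} k G) [FiniteDimensional k M.V]
    (hM : M.Indecomposable) :
    ∃ e, 0 < e ∧ e ≤ p ^ a ∧ e ≤ Module.finrank k M.V ∧
      IsRetractAlong (.id G) M.ρ (cyclicQuotient k x e).ρ := by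
  classical
  have := hM.1
  have := Fintype.ofFinite (G ⧸ P)
  let N : Module.End k M.V := M.ρ x - 1
  let T := Module.AEval' N
  let τ : M.V ≃ₗ[k] T := Module.AEval'.of N
  have hN : N ^ p ^ a = 0 := sub_one_pow_eq_zero p M x a hx
  have htors : ∀ v : T, (X ^ p ^ a : k[X]) • v = 0 := by
    intro v
    obtain ⟨v, rfl⟩ := τ.surjective v
    rw [Module.AEval'.smul_of, map_pow, aeval_X, hN, LinearMap.zero_apply, map_zero]
  obtain ⟨d, e, ⟨E⟩⟩ := Module.torsion_by_prime_power_decomposition (R := k[X]) (M := T)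
    Polynomial.irreducible_X (fun {v} => ⟨⟨X ^ p ^ a, p ^ a, rfl⟩, htors v⟩)
  let ι : ∀ i, (k[X] ⧸ k[X] ∙ (X : k[X]) ^ e i) →ₗ[k[X]] T := fun i =>
    E.symm.toLinearMap ∘ₗ DirectSum.lof k[X] (Fin d) (fun i => k[X] ⧸ k[X] ∙ (X : k[X]) ^ e i) i
  let π : ∀ i, T →ₗ[k[X]] (k[X] ⧸ k[X] ∙ (X : k[X]) ^ e i) := fun i =>
    DirectSum.component k[X] (Fin d) (fun i => k[X] ⧸ k[X] ∙ (X : k[X]) ^ e i) i ∘ₗ E.toLinearMap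
  have hsum : ∀ t : T, ∑ i, ι i (π i t) = t := by
    intro t
    apply E.injective
    rw [map_sum]
    conv_rhs => rw [← DirectSum.sum_univ_of (E t)]
    refine Finset.sum_congr rfl fun i _ => ?_
    exact E.apply_symm_apply _
  have hιinj : ∀ i, Function.Injective (ι i) := fun i =>
    E.symm.injective.comp (DirectSum.of_injective i)
  choose γ hγ using fun i => exists_cyclicQuotient_map (k := k) x (e i)
  have hv : ∀ i, (N ^ e i) (τ.symm (ι i (Submodule.Quotient.mk 1))) = 0 := by
    intro i
    have h0 : (X ^ e i : k[X]) • ι i (Submodule.Quotient.mk 1) = 0 := by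
      rw [← map_smul, ← Submodule.Quotient.mk_smul, smul_eq_mul, mul_one,
        (Submodule.Quotient.mk_eq_zero _).2 (Submodule.mem_span_singleton_self _), map_zero]
    have h1 := Module.AEval'.of_symm_smul N (X ^ e i) (ι i (Submodule.Quotient.mk 1))
    rw [h0, map_zero, map_pow, aeval_X] at h1
    exact h1.symm
  choose β hβ hβ1 using fun i => exists_cyclicQuotient_lift M x (e i) _ (hv i)
  let F : ∀ i, M.V →ₗ[k] (cyclicQuotient k x (e i)).V := fun i =>
    (Module.AEval'.of _).symm.toLinearMap ∘ₗ (γ i ∘ₗ π i).restrictScalars k ∘ₗ τ.toLinearMap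
  have hF : ∀ i, ∀ h ∈ P, ∀ v, F i (M.ρ h v) = (cyclicQuotient k x (e i)).ρ h (F i v) := by
    intro i
    have h1 : ∀ v, F i (M.ρ x v) = (cyclicQuotient k x (e i)).ρ x (F i v) := by
      intro v
      have h2 : F i (N v) = ((cyclicQuotient k x (e i)).ρ x - 1) (F i v) := by
        change (Module.AEval'.of _).symm (γ i (π i (Module.AEval'.of N (N v)))) = _
        rw [← Module.AEval'.X_smul_of, map_smul, map_smul, Module.AEval'.of_symm_smul, aeval_X]
        rfl
      have h3 : M.ρ x v = N v + v := by simp [N]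
      rw [h3, map_add, h2]
      simp
    have hpow : ∀ (n : ℕ) v,
        F i (M.ρ (x ^ n) v) = (cyclicQuotient k x (e i)).ρ (x ^ n) (F i v) := by
      intro n
      induction n with
      | zero => simp
      | succ n ih =>
        intro v
        rw [pow_succ, map_mul, map_mul, Module.End.mul_apply, Module.End.mul_apply, ih, h1]
    intro h hh
    obtain ⟨n, rfl⟩ := hxP h hh
    exact hpow n
  have hβF : ∀ i v, β i (F i v) = τ.symm (ι i (π i (τ v))) := by
    intro i v
    change β i ((Module.AEval'.of _).symm (γ i (π i (τ v)))) = _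
    obtain ⟨f, hf⟩ := Submodule.Quotient.mk_surjective _ (π i (τ v))
    have hf1 : π i (τ v) = f • Submodule.Quotient.mk 1 := by
      rw [← hf, ← Submodule.Quotient.mk_smul, smul_eq_mul, mul_one]
    rw [hf1, map_smul (γ i), hγ, map_smul (ι i), Module.AEval'.of_symm_smul,
      Module.AEval'.of_symm_smul,
      LinearEquiv.symm_apply_apply,
      Module.AEval'.aeval_map_of_comm (T := N) (β i) (fun y => by simp [N, hβ]), hβ1]
  let α : ∀ i, M.V →ₗ[k] (cyclicQuotient k x (e i)).V := fun i =>
    relTrace M.ρ (cyclicQuotient k x (e i)).ρ P (F i)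
  have hα : ∀ i g v, α i (M.ρ g v) = (cyclicQuotient k x (e i)).ρ g (α i v) := fun i =>
    relTrace_comm _ _ P (F i) (hF i)
  have htotal : ∀ v, (∑ i, β i ∘ₗ α i) v = (P.index : k) • v := by
    intro v
    simp only [LinearMap.sum_apply, LinearMap.comp_apply, α, relTrace, map_sum, hβ, hβF]
    rw [Finset.sum_comm]
    simp only [← map_sum, hsum]
    simp [Subgroup.index, Nat.card_eq_fintype_card, ← Nat.cast_smul_eq_nsmul k]
  obtain ⟨i, -, hi⟩ := hM.hasLocalEnd.exists_injective_of_sum Finset.univ (fun i => β i ∘ₗ α i)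
    (fun i g => LinearMap.ext fun v => by simp [hα, hβ]) (fun v w hvw => by
      rw [htotal, htotal] at hvw
      exact smul_right_injective _ hindex hvw)
  have hret : IsRetractAlong (.id G) M.ρ (cyclicQuotient k x (e i)).ρ :=
    ⟨α i, β i, hα i, hβ i, hi⟩
  refine ⟨e i, ?_, ?_, ?_, hret⟩
  · have h1 := hret.finrank_le.trans (finrank_cyclicQuotient_le P x hxP (e i))
    have h2 := Module.finrank_pos (R := k) (M := M.V)
    by_contra h0
    simp only [not_lt, nonpos_iff_eq_zero] at h0
    rw [h0] at h1
    omega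
  · have h0 : (X ^ p ^ a : k[X]) • (Submodule.Quotient.mk 1 : k[X] ⧸ k[X] ∙ (X : k[X]) ^ e i) = 0 :=
      hιinj i (by rw [map_smul, htors, map_zero])
    rw [← Submodule.Quotient.mk_smul, Submodule.Quotient.mk_eq_zero, smul_eq_mul, mul_one,
      Submodule.mem_span_singleton] at h0
    obtain ⟨f, hf⟩ := h0
    have hdvd : (X : k[X]) ^ e i ∣ X ^ p ^ a := ⟨f, by rw [← hf, smul_eq_mul, mul_comm]⟩
    exact (pow_dvd_pow_iff X_ne_zero not_isUnit_X).1 hdvd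
  · have h1 := LinearMap.finrank_le_finrank_of_injective
      (f := τ.symm.toLinearMap ∘ₗ (ι i).restrictScalars k) (τ.symm.injective.comp (hιinj i))
    rwa [show Module.finrank k (k[X] ⧸ k[X] ∙ (X : k[X]) ^ e i) = e i from
      finrank_quotient_span_eq_natDegree.trans (natDegree_X_pow _)] at h1

end Cyclic

end Rep

namespace Rep

open Representation

universe w

section Family

variable (p : ℕ) [Fact p.Prime] (G : Type) [Group G] [Fintype G]

theorem exists_family_of_isCyclic_sylow (hG : ∀ P : Sylow p G, IsCyclic ↥(P : Subgroup G)) :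
    ∃ f : Fin (Fintype.card G) → Rep.{w} (ZMod p) G, ∀ M : Rep.{w} (ZMod p) G,
      FiniteDimensional (ZMod p) M.V → M.Indecomposable → ∃ i, Nonempty (M ≅ f i) := by
  obtain ⟨P⟩ : Nonempty (Sylow p G) := inferInstance
  have := hG P
  obtain ⟨⟨x, hxmem⟩, hx⟩ := IsCyclic.exists_monoid_generator (α := ↥(P : Subgroup G))
  have hxP : ∀ h ∈ (P : Subgroup G), ∃ n : ℕ, x ^ n = h := by
    intro h hh
    obtain ⟨n, hn⟩ := Submonoid.mem_powers_iff _ _ |>.1 (hx ⟨h, hh⟩)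
    exact ⟨n, congrArg Subtype.val hn⟩
  obtain ⟨a, ha⟩ := IsPGroup.iff_card.1 P.isPGroup'
  have hxa : x ^ p ^ a = 1 := by
    have h1 : (⟨x, hxmem⟩ : ↥(P : Subgroup G)) ^ p ^ a = 1 := by
      rw [← ha]
      exact pow_card_eq_one'
    exact congrArg Subtype.val h1
  have hindex : ((P : Subgroup G).index : ZMod p) ≠ 0 := by
    rw [Ne, ZMod.natCast_eq_zero_iff]
    exact P.not_dvd_index
  choose L hL hL' using fun e : Fin (p ^ a) => exists_list_of_isRetractAlong.{0, w}
    (cyclicQuotient (ZMod p) x (e + 1)) (e + 1) e.val.succ_pos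
  have hlen : ∀ e, (L e).length ≤ (P : Subgroup G).index := fun e =>
    Nat.le_of_mul_le_mul_left
      ((mul_comm _ _).trans_le ((hL e).trans (finrank_cyclicQuotient_le _ x hxP _)))
      e.val.succ_pos
  have hcard : p ^ a * (P : Subgroup G).index = Fintype.card G := by
    rw [← ha, Subgroup.card_mul_index, Nat.card_eq_fintype_card]
  let c : Fin (p ^ a) × Fin (P : Subgroup G).index ≃ Fin (Fintype.card G) :=
    finProdFinEquiv.trans (finCongr hcard)
  refine ⟨fun i => ulift.{0, w}
    ((L (c.symm i).1).getD (c.symm i).2 (cyclicQuotient (ZMod p) x 0)), fun M hfd hM => ?_⟩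
  obtain ⟨e, he0, hea, heM, hr⟩ :=
    exists_isRetractAlong_cyclicQuotient p (P : Subgroup G) x hxP a hxa hindex M hM
  obtain ⟨e, rfl⟩ := Nat.exists_eq_add_of_lt he0
  rw [zero_add] at hea heM hr
  obtain ⟨Y, hY, ⟨E⟩⟩ := hL' ⟨e, hea⟩ M hfd hM heM hr
  obtain ⟨j, hj, rfl⟩ := List.getElem_of_mem hY
  refine ⟨c (⟨e, hea⟩, ⟨j, hj.trans_le (hlen _)⟩), ?_⟩
  beta_reduce
  rw [Equiv.symm_apply_apply, List.getD_eq_getElem _ _ hj]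
  exact ⟨Rep.mkIso (E.trans (uliftEquiv.{0, w} _))⟩

end Family

end Rep

theorem IsPGroup.exists_hom_of_isCoatom {p : ℕ} [Fact p.Prime] {P : Type*} [Group P] [Finite P]
    (hP : IsPGroup p P) {H : Subgroup P} (hH : IsCoatom H) {a : P} (ha : a ∉ H) :
    ∃ f : P →* Multiplicative (ZMod p), (∀ h ∈ H, f h = 1) ∧ f a = Multiplicative.ofAdd 1 := by
  have := hP.isNilpotent
  have hnormal : H.Normal :=
    Subgroup.NormalizerCondition.normal_of_coatom H Group.normalizerCondition_of_isNilpotent hH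
  obtain ⟨n, hn⟩ := IsPGroup.iff_card.1 (hP.to_subgroup H)
  obtain ⟨m, hm⟩ := IsPGroup.iff_card.1 hP
  have hlt : n < m := by
    refine (Nat.pow_lt_pow_iff_right (Fact.out : p.Prime).one_lt).1 ?_
    rw [← hn, ← hm]
    refine lt_of_le_of_ne (Subgroup.card_le_card_group H) fun h => hH.1 ?_
    exact Subgroup.eq_top_of_card_eq H h
  obtain ⟨K, hK, hHK⟩ := Sylow.exists_subgroup_card_pow_prime_le (p := p) (n := n) (m := n + 1)
    (hm ▸ pow_dvd_pow p hlt) H hn n.le_succ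
  have hKtop : K = ⊤ := hH.2 K (lt_of_le_of_ne hHK fun h => by
    rw [← h, hn] at hK
    exact absurd (Nat.pow_right_injective (Fact.out : p.Prime).two_le hK) n.succ_ne_self.symm)
  have hcard : Nat.card (P ⧸ H) = p := by
    have h1 := H.card_mul_index
    rw [hn, ← Subgroup.card_top (G := P), ← hKtop, hK, pow_succ] at h1
    exact Nat.eq_of_mul_eq_mul_left (pow_pos (Fact.out : p.Prime).pos n) h1
  let E : P ⧸ H ≃* Multiplicative (ZMod p) := mulEquivOfPrimeCardEq (p := p) hcard (by simp)
  let r : ZMod p := Multiplicative.toAdd (E a)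
  have hr : r ≠ 0 := by
    intro h
    refine ha ((QuotientGroup.eq_one_iff a).1 (E.injective ?_))
    rw [map_one]
    exact h
  refine ⟨(AddMonoidHom.toMultiplicative (AddMonoidHom.mulLeft r⁻¹)).comp
    (E.toMonoidHom.comp (QuotientGroup.mk' H)), fun h hh => ?_, ?_⟩
  · simp [(QuotientGroup.eq_one_iff h).2 hh]
  · exact congrArg Multiplicative.ofAdd (inv_mul_cancel₀ hr)

theorem isCyclic_of_subsingleton_coatoms {P : Type*} [Group P] [Finite P]
    (h : ∀ H K : Subgroup P, IsCoatom H → IsCoatom K → H = K) : IsCyclic P := by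
  by_cases hex : ∃ H : Subgroup P, IsCoatom H
  · obtain ⟨H, hH⟩ := hex
    obtain ⟨x, -, hx⟩ := SetLike.exists_of_lt hH.1.lt_top
    refine ⟨x, fun y => ?_⟩
    have htop : Subgroup.zpowers x = ⊤ := by
      refine (eq_top_or_exists_le_coatom _).resolve_right ?_
      rintro ⟨K, hK, hle⟩
      exact hx (h K H hK hH ▸ hle (Subgroup.mem_zpowers x))
    exact (htop ▸ Subgroup.mem_top y : y ∈ Subgroup.zpowers x)
  · have hbot : (⊥ : Subgroup P) = ⊤ :=
      (eq_top_or_exists_le_coatom _).resolve_right fun ⟨K, hK, _⟩ => hex ⟨K, hK⟩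
    refine ⟨1, fun y => ?_⟩
    have : y ∈ (⊥ : Subgroup P) := hbot ▸ Subgroup.mem_top y
    rw [Subgroup.mem_bot.1 this]
    exact one_mem (Subgroup.zpowers (1 : P))

theorem IsPGroup.exists_hom_pair_of_not_isCyclic {p : ℕ} [Fact p.Prime] {P : Type*} [Group P]
    [Finite P] (hP : IsPGroup p P) (hcyc : ¬ IsCyclic P) :
    ∃ (f₁ f₂ : P →* Multiplicative (ZMod p)) (a b : P), f₁ a = Multiplicative.ofAdd 1 ∧
      f₂ a = 1 ∧ f₁ b = 1 ∧ f₂ b = Multiplicative.ofAdd 1 := by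
  have h := mt isCyclic_of_subsingleton_coatoms hcyc
  push Not at h
  obtain ⟨H, K, hH, hK, hne⟩ := h
  obtain ⟨a, haK, haH⟩ := SetLike.not_le_iff_exists.1 fun hle : K ≤ H =>
    hne ((hK.le_iff.1 hle).resolve_left hH.1)
  obtain ⟨b, hbH, hbK⟩ := SetLike.not_le_iff_exists.1 fun hle : H ≤ K =>
    hne.symm ((hH.le_iff.1 hle).resolve_left hK.1)
  obtain ⟨f₁, h₁, h₁'⟩ := hP.exists_hom_of_isCoatom hH haH
  obtain ⟨f₂, h₂, h₂'⟩ := hP.exists_hom_of_isCoatom hK hbK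
  exact ⟨f₁, f₂, a, b, h₁', h₂ a haK, h₁ b hbH, h₂'⟩

namespace Representation

section Shear

variable (F : Type*) {K P : Type*} [Field F] [Field K] [Algebra F K] [Group P]

/-- The representation on `K × K` in which `g` acts by `(u, v) ↦ (u, v + c g * u)`. -/
def shear (c : P →* Multiplicative K) :
    Representation F P (K × K) where
  toFun g := LinearMap.prod (LinearMap.fst F K K)
    (LinearMap.snd F K K + LinearMap.mulLeft F (c g).toAdd ∘ₗ LinearMap.fst F K K)
  map_one' := by ext <;> simp
  map_mul' g h := by ext <;> simp [add_comm, add_mul]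

theorem shear_apply (c : P →* Multiplicative K) (g : P) (w : K × K) :
    shear F c g w = (w.1, w.2 + (c g).toAdd * w.1) := rfl

variable {F} in
theorem hasLocalEnd_shear (c : P →* Multiplicative K) {a b : P} {t : K}
    (ha : (c a).toAdd = 1) (hb : (c b).toAdd = t) (ht : Algebra.adjoin F {t} = ⊤) :
    (shear F c).HasLocalEnd := by
  have key : ∀ φ : Module.End F (K × K), (∀ h, Commute φ (shear F c h)) →
      (∀ y, φ (0, y) = (0, (φ (1, 0)).1 * y)) ∧ ∀ w, (φ w).1 = (φ (1, 0)).1 * w.1 := by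
    intro φ hφ
    have h1 : ∀ g u, φ (0, (c g).toAdd * u) = (0, (c g).toAdd * (φ (u, 0)).1) := by
      intro g u
      have h2 := LinearMap.congr_fun (hφ g) (u, 0)
      simp only [Module.End.mul_apply, shear_apply, zero_add] at h2
      have h3 : ((u, (c g).toAdd * u) : K × K) = (u, 0) + (0, (c g).toAdd * u) := by simp
      rw [h3, map_add] at h2
      have h4 := eq_sub_of_add_eq' h2
      rw [h4]
      ext <;> simp
    have hα : ∀ u, φ (0, u) = (0, (φ (u, 0)).1) := by
      intro u
      have := h1 a u
      rwa [ha, one_mul, one_mul] at this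
    have ht' : ∀ u, (φ (t * u, 0)).1 = t * (φ (u, 0)).1 := by
      intro u
      have := h1 b u
      rw [hb, hα] at this
      exact (Prod.ext_iff.1 this).2
    have hmul : ∀ y u, (φ (y * u, 0)).1 = y * (φ (u, 0)).1 := by
      intro y
      have hy : y ∈ Algebra.adjoin F {t} := ht ▸ Algebra.mem_top
      induction hy using Algebra.adjoin_induction with
      | mem x hx => rw [Set.mem_singleton_iff.1 hx]; exact ht'
      | algebraMap r =>
        intro u
        have : ((algebraMap F K r * u, 0) : K × K) = r • (u, 0) := by
          simp [Algebra.smul_def]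
        rw [this, map_smul, Prod.smul_fst, Algebra.smul_def]
      | add x y _ _ hx hy =>
        intro u
        have : (((x + y) * u, 0) : K × K) = (x * u, 0) + (y * u, 0) := by simp [add_mul]
        rw [this, map_add, Prod.fst_add, hx, hy, add_mul]
      | mul x y _ _ hx hy =>
        intro u
        rw [mul_assoc, hx, hy, mul_assoc]
    have hone : ∀ u, (φ (u, 0)).1 = (φ (1, 0)).1 * u := by
      intro u
      rw [← mul_one u, hmul, mul_one, mul_comm]
    refine ⟨fun y => by rw [hα, hone], fun w => ?_⟩
    have : w = (w.1, 0) + (0, w.2) := by simp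
    conv_lhs => rw [this]
    rw [map_add, Prod.fst_add, hα, hone, add_zero]
  have hinj : ∀ φ : Module.End F (K × K), (∀ h, Commute φ (shear F c h)) →
      (φ (1, 0)).1 ≠ 0 → Function.Injective φ := by
    intro φ hφ h0
    rw [injective_iff_map_eq_zero]
    intro w hw
    obtain ⟨h1, h2⟩ := key φ hφ
    have hw1 : w.1 = 0 := by
      have := h2 w
      rw [hw] at this
      exact (mul_eq_zero.1 this.symm).resolve_left h0
    have hw' : w = (0, w.2) := Prod.ext hw1 rfl
    rw [hw', h1] at hw
    rw [hw', (mul_eq_zero.1 (Prod.ext_iff.1 hw).2).resolve_left h0]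
    rfl
  intro φ ψ hφ hψ hsum
  by_contra! hcon
  have h1 : (φ (1, 0)).1 = 0 := by_contra fun h => hcon.1 (hinj φ hφ h)
  have h2 : (ψ (1, 0)).1 = 0 := by_contra fun h => hcon.2 (hinj ψ hψ h)
  have h3 : (φ + ψ) ((0, 1) : K × K) = (φ + ψ) 0 := by
    rw [map_zero, LinearMap.add_apply, (key φ hφ).1, (key ψ hψ).1, h1, h2]
    simp
  simpa using hsum h3

end Shear

section Coind

variable {F : Type*} [Field F] {G W : Type*} [Group G] [AddCommGroup W] [Module F W]

theorem isRetractAlong_coind (P : Subgroup G) (σ : Representation F P W) :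
    IsRetractAlong P.subtype σ (coind P.subtype σ) := by
  classical
  have hpos : ∀ (w : W) (g : P) (x : G), x ∈ P →
      (if hx : (g : G) * x ∈ P then σ ⟨_, hx⟩ w else 0) =
        σ g (if hx : x ∈ P then σ ⟨x, hx⟩ w else 0) := by
    intro w g x hx
    rw [dif_pos hx, dif_pos (mul_mem g.2 hx), ← Module.End.mul_apply, ← map_mul]
    rfl
  let α : W →ₗ[F] coindV P.subtype σ :=
    { toFun w := ⟨fun x => if hx : x ∈ P then σ ⟨x, hx⟩ w else 0, by
        intro g x
        by_cases hx : x ∈ P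
        · exact hpos w g x hx
        · have : (g : G) * x ∉ P := fun h => hx ((Subgroup.mul_mem_cancel_left P g.2).1 h)
          simp [this, hx]⟩
      map_add' u v := by
        ext x
        by_cases hx : x ∈ P <;> simp [hx]
      map_smul' r v := by
        ext x
        by_cases hx : x ∈ P <;> simp [hx] }
  have hα : ∀ w x, (α w).1 x = if hx : x ∈ P then σ ⟨x, hx⟩ w else 0 := fun _ _ => rfl
  have hcoind : ∀ (g : G) (v : coindV P.subtype σ) (x : G),
      (coind P.subtype σ g v).1 x = v.1 (x * g) := fun _ _ _ => rfl
  let β : coindV P.subtype σ →ₗ[F] W := LinearMap.proj 1 ∘ₗ (coindV P.subtype σ).subtype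
  have hβ : ∀ v, β v = v.1 1 := fun _ => rfl
  have hβα : ∀ w, (β ∘ₗ α) w = w := by
    intro w
    rw [LinearMap.comp_apply, hβ, hα, dif_pos (one_mem P)]
    exact LinearMap.congr_fun (map_one σ) w
  refine ⟨α, β, fun h w => ?_, fun h v => ?_, fun u v huv => ?_⟩
  · refine Subtype.ext (funext fun x => ?_)
    rw [hcoind, hα, hα, Subgroup.subtype_apply]
    by_cases hx : x ∈ P
    · rw [dif_pos hx, dif_pos (mul_mem hx h.2), ← Module.End.mul_apply, ← map_mul]
      rfl
    · rw [dif_neg hx, dif_neg fun hh => hx ((Subgroup.mul_mem_cancel_right P h.2).1 hh)]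
  · have := v.2 h 1
    rwa [hβ, hβ, hcoind, one_mul, ← mul_one (P.subtype h)]
  · rwa [hβα, hβα] at huv

end Coind

end Representation

namespace Rep

open Representation

universe w

section Unbounded

variable (p : ℕ) [Fact p.Prime] (G : Type) [Group G] [Finite G]

theorem exists_indecomposable_le_finrank (P : Sylow p G) (hP : ¬ IsCyclic ↥(P : Subgroup G))
    (n : ℕ) (hn : n ≠ 0) :
    ∃ M : Rep.{w} (ZMod p) G, FiniteDimensional (ZMod p) M.V ∧ M.Indecomposable ∧
      n ≤ Module.finrank (ZMod p) M.V := by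
  obtain ⟨f₁, f₂, a, b, h1a, h2a, h1b, h2b⟩ := P.isPGroup'.exists_hom_pair_of_not_isCyclic hP
  let K := GaloisField p n
  obtain ⟨t, ht⟩ := Field.exists_primitive_element_of_finite_top (ZMod p) K
  have hadj : Algebra.adjoin (ZMod p) {t} = ⊤ := by
    rw [← IntermediateField.adjoin_simple_toSubalgebra_of_isAlgebraic (.of_finite (ZMod p) t), ht,
      IntermediateField.top_toSubalgebra]
  let c₁ : ZMod p →+ K := (algebraMap (ZMod p) K).toAddMonoidHom
  let c : ↥(P : Subgroup G) →* Multiplicative K :=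
    (AddMonoidHom.toMultiplicative c₁).comp f₁ *
      (AddMonoidHom.toMultiplicative ((AddMonoidHom.mulRight t).comp c₁)).comp f₂
  have hc : ∀ g, (c g).toAdd =
      algebraMap (ZMod p) K (f₁ g).toAdd + algebraMap (ZMod p) K (f₂ g).toAdd * t := fun _ => rfl
  have hlocal : (shear (ZMod p) c).HasLocalEnd :=
    hasLocalEnd_shear c (a := a) (b := b) (t := t) (by simp [hc, h1a, h2a])
      (by simp [hc, h1b, h2b]) hadj
  let X : Rep.{0} (ZMod p) G :=
    Rep.of (Representation.coind (P : Subgroup G).subtype (shear (ZMod p) c))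
  have hX : FiniteDimensional (ZMod p) X.V :=
    inferInstanceAs (FiniteDimensional (ZMod p)
      (coindV (P : Subgroup G).subtype (shear (ZMod p) c)))
  have hret : IsRetractAlong (P : Subgroup G).subtype (shear (ZMod p) c) X.ρ :=
    isRetractAlong_coind _ _
  have hX' : FiniteDimensional (ZMod p) (ulift.{0, w} X).V :=
    (uliftEquiv.{0, w} X).toLinearEquiv.finiteDimensional
  obtain ⟨M, hfd, hM, hle⟩ := exists_indecomposable_of_isRetractAlong hlocal (ulift.{0, w} X)
    (hret.trans_equiv (uliftEquiv X))
  refine ⟨M, hfd, hM, le_trans ?_ hle⟩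
  rw [Module.finrank_prod, GaloisField.finrank p hn]
  omega

theorem isCyclic_sylow_of_finite_family (N : ℕ) (f : Fin N → Rep.{w} (ZMod p) G)
    (hf : ∀ M : Rep.{w} (ZMod p) G, FiniteDimensional (ZMod p) M.V → M.Indecomposable →
      ∃ i, Nonempty (M ≅ f i)) (P : Sylow p G) : IsCyclic ↥(P : Subgroup G) := by
  by_contra hP
  obtain ⟨M, hfd, hM, hle⟩ := exists_indecomposable_le_finrank.{w} p G P hP
    (∑ i, Module.finrank (ZMod p) (f i).V + 1) (Nat.succ_ne_zero _)
  obtain ⟨i, ⟨E⟩⟩ := hf M hfd hM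
  have h1 := (Representation.equivOfIso E).toLinearEquiv.finrank_eq
  have h2 := Finset.single_le_sum (f := fun i => Module.finrank (ZMod p) (f i).V)
    (fun _ _ => Nat.zero_le _) (Finset.mem_univ i)
  omega

end Unbounded

end Rep

/-- Higman.  Let `p` be a prime and `Q` a finite group.  There are only
finitely many isomorphism classes of indecomposable finite-dimensional `𝔽_p`-linear
representations of `Q` if and only if the Sylow `p`-subgroups of `Q` are cyclic; moreover,
when the Sylow `p`-subgroups are cyclic, a family of at most `|Q|` representations suffices
to cover all indecomposables up to isomorphism. -/
theorem higman_finite_representation_type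
    (p : ℕ) [Fact p.Prime] (Q : Type) [Group Q] [Fintype Q] :
    ((∃ (N : ℕ) (f : Fin N → Rep (ZMod p) Q), ∀ M : Rep (ZMod p) Q,
        FiniteDimensional (ZMod p) M.V → M.Indecomposable → ∃ i, Nonempty (M ≅ f i)) ↔
      ∀ P : Sylow p Q, IsCyclic ↥(P : Subgroup Q)) ∧
    ((∀ P : Sylow p Q, IsCyclic ↥(P : Subgroup Q)) →
      ∃ f : Fin (Fintype.card Q) → Rep (ZMod p) Q, ∀ M : Rep (ZMod p) Q,
        FiniteDimensional (ZMod p) M.V → M.Indecomposable → ∃ i, Nonempty (M ≅ f i)) :=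
  ⟨⟨fun ⟨N, f, hf⟩ => Rep.isCyclic_sylow_of_finite_family p Q N f hf,
    fun h => ⟨Fintype.card Q, Rep.exists_family_of_isCyclic_sylow p Q h⟩⟩,
    Rep.exists_family_of_isCyclic_sylow p Q⟩
end
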